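/- Let n ≥ 7 with n ≡ 3 (mod 4) and let P_n be the regular n-gon with unit circumradius. Then A(P_n) = n·tan(π/n) + (sin⁴(π/n)/cos²(π/n))·(((n+1)/4)·tan(2π/n) − tan(π/(2n))). -/

import Mathlib

open MeasureTheory Real

noncomputable section

/-- The plane. -/
abbrev E2 := EuclideanSpace ℝ (Fin 2)

/-- The `k`-th vertex of the regular `n`-gon with unit circumradius. -/
def regVtx (n k : ℕ) : E2 :=
  (WithLp.equiv 2 (Fin 2 → ℝ)).symm ![Real.cos (2 * Real.pi * k / n), Real.sin (2 * Real.pi * k / n)]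

/-- The regular `n`-gon with unit circumradius. -/
def regPoly (n : ℕ) : Set E2 := convexHull ℝ (Set.range fun k : Fin n => regVtx n k)

/-- A convex polygon: the convex hull of a finite set of points. -/
def IsConvexPolygon (Q : Set E2) : Prop := ∃ F : Finset E2, Q = convexHull ℝ (F : Set E2)

/-- The supremum of the areas of convex polygons circumscribed about the regular `n`-gon. -/
def maxCircArea (n : ℕ) : ℝ :=
  sSup {A : ℝ | ∃ Q : Set E2, IsConvexPolygon Q ∧ regPoly n ⊆ Q ∧
    (∀ k : Fin n, regVtx n k ∈ frontier Q) ∧ (volume Q).toReal = A}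

/-- The area of the triangle cut off above an edge of length `2 sin θ`, by lines making angles
`θ + a` and `θ - b` with that edge. -/
def capArea (θ a b : ℝ) : ℝ := 2 * sin θ ^ 2 * sin (θ + a) * sin (θ - b) / sin (2 * θ + a - b)

/-- Minus the classical action of a harmonic oscillator that moves from `sin a` to `-sin b` during
a time `2 θ + a - b`. -/
def gain (θ a b : ℝ) : ℝ :=
  -((sin a ^ 2 + sin b ^ 2) * cos (2 * θ + a - b) + 2 * sin a * sin b) / sin (2 * θ + a - b)

theorem capArea_eq {θ a b : ℝ} (hθ : 0 < θ) (hθ' : θ < π / 4) (ha : |a| ≤ θ) (hb : |b| ≤ θ) :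
    capArea θ a b = tan θ * sin θ ^ 2 - tan θ ^ 2 / 2 * (sin b * cos b - sin a * cos a)
      + tan θ ^ 2 / 2 * gain θ a b := by
  obtain ⟨ha1, ha2⟩ := abs_le.1 ha
  obtain ⟨hb1, hb2⟩ := abs_le.1 hb
  have hc : 0 < cos θ := cos_pos_of_mem_Ioo ⟨by linarith, by linarith⟩
  unfold capArea gain
  rcases eq_or_lt_of_le (show 0 ≤ 2 * θ + a - b by linarith) with h0 | h0
  · have h1 : a = -θ := by linarith
    have h2 : b = θ := by linarith
    rw [← h0, h1, h2, tan_eq_sin_div_cos]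
    simp only [sin_zero, sin_neg, cos_neg, div_zero, mul_zero, add_zero]
    field_simp
    ring
  · have hs : 0 < sin (2 * θ + a - b) := sin_pos_of_pos_of_lt_pi h0 (by linarith)
    rw [tan_eq_sin_div_cos]
    have e : 2 * θ + a - b = (θ + a) + (θ - b) := by ring
    have h1 := sin_sq_add_cos_sq θ
    have h2 := sin_sq_add_cos_sq a
    have h3 := sin_sq_add_cos_sq b
    rw [e] at hs ⊢
    have hs' := hs.ne'
    have key : 2 * sin (θ + a) * sin (θ - b) * cos θ ^ 2 = sin θ * cos θ * sin (θ + a + (θ - b))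
      - (sin b * cos b - sin a * cos a) * sin (θ + a + (θ - b)) / 2
      - ((sin a ^ 2 + sin b ^ 2) * cos (θ + a + (θ - b)) + 2 * sin a * sin b) / 2 := by
      simp only [sin_add, cos_add, sin_sub, cos_sub]
      grind
    field_simp
    field_simp at key
    linear_combination sin θ ^ 2 * key

theorem gain_le_tan {θ a b : ℝ} (hθ : 0 < θ) (hθ' : θ < π / 4) (ha : |a| ≤ θ) (hb : |b| ≤ θ) :
    gain θ a b ≤ sin a ^ 2 * tan (θ + a) + sin b ^ 2 * tan (θ - b) := by
  obtain ⟨ha1, ha2⟩ := abs_le.1 ha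
  obtain ⟨hb1, hb2⟩ := abs_le.1 hb
  have hA : 0 < cos (θ + a) := cos_pos_of_mem_Ioo ⟨by linarith, by linarith⟩
  have hB : 0 < cos (θ - b) := cos_pos_of_mem_Ioo ⟨by linarith, by linarith⟩
  unfold gain
  rcases eq_or_lt_of_le (show 0 ≤ 2 * θ + a - b by linarith) with h0 | h0
  · have h1 : a = -θ := by linarith
    have h2 : b = θ := by linarith
    rw [← h0, h1, h2]; simp
  · have hs : 0 < sin (2 * θ + a - b) := sin_pos_of_pos_of_lt_pi h0 (by linarith)
    have e : 2 * θ + a - b = (θ + a) + (θ - b) := by ring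
    rw [e] at hs ⊢
    rw [← sub_nonneg]
    have : sin a ^ 2 * tan (θ + a) + sin b ^ 2 * tan (θ - b) -
        -((sin a ^ 2 + sin b ^ 2) * cos (θ + a + (θ - b)) + 2 * sin a * sin b) /
          sin (θ + a + (θ - b)) =
        (sin a * cos (θ - b) + sin b * cos (θ + a)) ^ 2 /
          (cos (θ + a) * cos (θ - b) * sin (θ + a + (θ - b))) := by
      rw [tan_eq_sin_div_cos, tan_eq_sin_div_cos]
      generalize sin a = x at *
      generalize sin b = y at *
      have h1 := sin_sq_add_cos_sq (θ + a)
      have h2 := sin_sq_add_cos_sq (θ - b)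
      generalize θ + a = A at *
      generalize θ - b = B at *
      field_simp
      simp only [sin_add, cos_add]
      grind
    rw [this]
    positivity

/-- Comparison of the action on a time interval with the solution of the oscillator equation that
vanishes `p` before the beginning of the interval. -/
theorem action_le_cot {x y p τ : ℝ} (hp : 0 ≤ p) (hp0 : p = 0 → x = 0) (hτ : 0 ≤ τ)
    (hτ0 : τ = 0 → y = -x) (hpτ : p + τ < π) :
    -((x ^ 2 + y ^ 2) * cos τ + 2 * x * y) / sin τ ≤ x ^ 2 * cot p - y ^ 2 * cot (p + τ) := by
  rcases eq_or_lt_of_le hτ with h0 | h0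
  · simp [← h0, hτ0 h0.symm]
  rcases eq_or_lt_of_le hp with h1 | h1
  · simp [← h1, hp0 h1.symm, cot_eq_cos_div_sin]
    apply le_of_eq; ring
  have hs : 0 < sin τ := sin_pos_of_pos_of_lt_pi h0 (by linarith)
  have hs1 : 0 < sin p := sin_pos_of_pos_of_lt_pi h1 (by linarith)
  have hs2 : 0 < sin (p + τ) := sin_pos_of_pos_of_lt_pi (by linarith) (by linarith)
  rw [← sub_nonneg]
  have : x ^ 2 * cot p - y ^ 2 * cot (p + τ) - -((x ^ 2 + y ^ 2) * cos τ + 2 * x * y) / sin τ =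
      (x * sin (p + τ) + y * sin p) ^ 2 / (sin p * sin (p + τ) * sin τ) := by
    rw [cot_eq_cos_div_sin, cot_eq_cos_div_sin]
    have h1 := sin_sq_add_cos_sq p
    have h2 := sin_sq_add_cos_sq τ
    field_simp
    simp only [sin_add, cos_add]
    grind
  rw [this]
  positivity

/-- The directions of the outward normals of the supporting lines. -/
def dir (θ : ℝ) (a : ℤ → ℝ) (k : ℤ) : ℝ := 2 * θ * k - a k

/-- The gain of the edge from vertex `k` to vertex `k + 1`. -/
def edgeGain (θ : ℝ) (a : ℤ → ℝ) (k : ℤ) : ℝ := gain θ (a k) (a (k + 1))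

theorem dir_succ (θ : ℝ) (a : ℤ → ℝ) (k : ℤ) :
    dir θ a (k + 1) = dir θ a k + (2 * θ + a k - a (k + 1)) := by
  unfold dir; push_cast; ring

theorem sin_sq_le_of_abs_le {θ a : ℝ} (hθ : θ < π / 2) (ha : |a| ≤ θ) :
    sin a ^ 2 ≤ sin θ ^ 2 := by
  obtain ⟨ha1, ha2⟩ := abs_le.1 ha
  apply sq_le_sq'
  · rw [← sin_neg]; exact sin_le_sin_of_le_of_le_pi_div_two (by linarith) (by linarith) ha1
  · exact sin_le_sin_of_le_of_le_pi_div_two (by linarith) (by linarith) ha2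

theorem sin_sq_mul_tan_add_le {θ a : ℝ} (hθ : 0 < θ) (hθ' : θ < π / 4) (ha : |a| ≤ θ) :
    sin a ^ 2 * tan (θ - a) + sin a ^ 2 * tan (θ + a) ≤ sin θ ^ 2 * tan (2 * θ) := by
  obtain ⟨ha1, ha2⟩ := abs_le.1 ha
  have hA : 0 < cos (θ + a) := cos_pos_of_mem_Ioo ⟨by linarith, by linarith⟩
  have hB : 0 < cos (θ - a) := cos_pos_of_mem_Ioo ⟨by linarith, by linarith⟩
  have hC : 0 < cos (2 * θ) := cos_pos_of_mem_Ioo ⟨by linarith, by linarith⟩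
  have hS : 0 < sin (2 * θ) := sin_pos_of_pos_of_lt_pi (by linarith) (by linarith)
  have hsq := sin_sq_le_of_abs_le (by linarith) ha
  have e1 : cos (θ + a) * cos (θ - a) = cos (2 * θ) + (sin θ ^ 2 - sin a ^ 2) := by
    rw [cos_add, cos_sub, cos_two_mul]
    have h1 := sin_sq_add_cos_sq θ
    have h2 := sin_sq_add_cos_sq a
    grind
  have e2 : sin a ^ 2 * tan (θ - a) + sin a ^ 2 * tan (θ + a) =
      sin a ^ 2 * sin (2 * θ) / (cos (θ + a) * cos (θ - a)) := by
    rw [show 2 * θ = (θ + a) + (θ - a) by ring, sin_add (θ + a), tan_eq_sin_div_cos,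
      tan_eq_sin_div_cos]
    field_simp
    ring
  rw [e2, e1, tan_eq_sin_div_cos, ← mul_div_assoc]
  apply div_le_div₀ <;> nlinarith

section
variable {θ : ℝ} {a : ℤ → ℝ} (hθ : 0 < θ) (hθ' : θ < π / 4) (ha : ∀ k, |a k| ≤ θ)
include hθ hθ' ha

theorem sum_edgeGain_le_of_start (R : ℤ) (N : ℕ) :
    sin (a R) ^ 2 * tan (θ - a R) + ∑ i ∈ Finset.range N, edgeGain θ a (R + i) ≤
      N * (sin θ ^ 2 * tan (2 * θ)) + sin (a (R + N)) ^ 2 * tan (θ - a (R + N)) := by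
  induction N with
  | zero => simp
  | succ N ih =>
    rw [Finset.sum_range_succ]
    have h1 := gain_le_tan hθ hθ' (ha (R + N)) (ha (R + N + 1))
    have h2 := sin_sq_mul_tan_add_le hθ hθ' (ha (R + N))
    rw [show R + ((N + 1 : ℕ) : ℤ) = R + N + 1 by push_cast; ring]
    push_cast
    unfold edgeGain at *
    linarith

theorem sum_edgeGain_le_outer (R : ℤ) (N : ℕ) :
    ∑ i ∈ Finset.range (N + 1), edgeGain θ a (R + i) ≤
      sin (a R) ^ 2 * tan (θ + a R) + N * (sin θ ^ 2 * tan (2 * θ)) +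
        sin (a (R + N + 1)) ^ 2 * tan (θ - a (R + N + 1)) := by
  rw [Finset.sum_range_succ']
  have h1 := gain_le_tan hθ hθ' (ha R) (ha (R + 1))
  have h2 := sum_edgeGain_le_of_start hθ hθ' ha (R + 1) N
  have h3 : ∀ i : ℕ, R + ((i + 1 : ℕ) : ℤ) = R + 1 + i := fun i => by push_cast; ring
  simp only [h3, Nat.cast_zero, add_zero]
  rw [show R + N + 1 = R + 1 + (N : ℤ) by ring]
  have : edgeGain θ a R = gain θ (a R) (a (R + 1)) := rfl
  linarith

omit hθ' hθ in
theorem dir_le_dir_succ (k : ℤ) : dir θ a k ≤ dir θ a (k + 1) := by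
  rw [dir_succ]
  have := abs_le.1 (ha k)
  have := abs_le.1 (ha (k + 1))
  linarith

omit hθ' hθ in
theorem dir_mono : Monotone (dir θ a) := monotone_int_of_le_succ (dir_le_dir_succ ha)

omit hθ' hθ in
theorem sin_eq_neg_of_dir_eq (k : ℤ) (h : dir θ a (k + 1) = dir θ a k) :
    sin (a (k + 1)) = -sin (a k) := by
  rw [dir_succ] at h
  have h1 := abs_le.1 (ha k)
  have h2 := abs_le.1 (ha (k + 1))
  have h3 : a (k + 1) = θ := by linarith
  have h4 : a k = -θ := by linarith
  rw [h3, h4, sin_neg, neg_neg]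

omit hθ' hθ in
theorem edgeGain_le_cot (k : ℤ) {e : ℝ} (h1 : e ≤ dir θ a k) (h2 : dir θ a k = e → a k = 0)
    (h3 : dir θ a (k + 1) - e < π) :
    edgeGain θ a k ≤ sin (a k) ^ 2 * cot (dir θ a k - e)
      - sin (a (k + 1)) ^ 2 * cot (dir θ a (k + 1) - e) := by
  have hd := dir_succ θ a k
  have hle := dir_le_dir_succ ha k
  have := action_le_cot (x := sin (a k)) (y := sin (a (k + 1))) (p := dir θ a k - e)
    (τ := dir θ a (k + 1) - dir θ a k) (by linarith)
    (fun h => by rw [h2 (by linarith), sin_zero]) (by linarith)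
    (fun h => sin_eq_neg_of_dir_eq ha k (by linarith)) (by linarith)
  rw [show dir θ a k - e + (dir θ a (k + 1) - dir θ a k) = dir θ a (k + 1) - e by ring] at this
  refine le_trans (le_of_eq ?_) this
  unfold edgeGain gain
  rw [hd]; ring_nf

omit hθ' hθ in
theorem edgeGain_le_cot' (k : ℤ) {e : ℝ} (h1 : dir θ a (k + 1) ≤ e)
    (h2 : dir θ a (k + 1) = e → a (k + 1) = 0) (h3 : e - dir θ a k < π) :
    edgeGain θ a k ≤ sin (a (k + 1)) ^ 2 * cot (e - dir θ a (k + 1))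
      - sin (a k) ^ 2 * cot (e - dir θ a k) := by
  have hd := dir_succ θ a k
  have hle := dir_le_dir_succ ha k
  have := action_le_cot (x := sin (a (k + 1))) (y := sin (a k)) (p := e - dir θ a (k + 1))
    (τ := dir θ a (k + 1) - dir θ a k) (by linarith)
    (fun h => by rw [h2 (by linarith), sin_zero]) (by linarith)
    (fun h => by rw [sin_eq_neg_of_dir_eq ha k (by linarith), neg_neg]) (by linarith)
  rw [show e - dir θ a (k + 1) + (dir θ a (k + 1) - dir θ a k) = e - dir θ a k by ring] at this
  refine le_trans (le_of_eq ?_) this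
  unfold edgeGain gain
  rw [hd]; ring_nf

omit hθ' hθ in
theorem sum_edgeGain_le_right (j : ℤ) (N : ℕ) {e : ℝ} (h1 : e ≤ dir θ a j)
    (h2 : dir θ a j = e → a j = 0) (h3 : dir θ a (j + N) - e < π) :
    ∑ i ∈ Finset.range N, edgeGain θ a (j + i) ≤ sin (a j) ^ 2 * cot (dir θ a j - e)
      - sin (a (j + N)) ^ 2 * cot (dir θ a (j + N) - e) := by
  induction N generalizing j with
  | zero => simp
  | succ N ih =>
    have hle := dir_le_dir_succ ha j
    have e3 : j + ((N + 1 : ℕ) : ℤ) = j + 1 + N := by push_cast; ring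
    have hm : dir θ a (j + 1) ≤ dir θ a (j + 1 + N) := dir_mono ha (by omega)
    rw [e3] at h3 ⊢
    have hj := edgeGain_le_cot ha j h1 h2 (by linarith)
    rw [Finset.sum_range_succ']
    simp only [Nat.cast_zero, add_zero]
    have h4 : ∀ i : ℕ, j + ((i + 1 : ℕ) : ℤ) = j + 1 + i := fun i => by push_cast; ring
    simp only [h4]
    have := ih (j + 1) (by linarith) (fun h => by
      have h5 : dir θ a j = e := by linarith
      have h6 := dir_succ θ a j
      have := abs_le.1 (ha j)
      have := abs_le.1 (ha (j + 1))
      have := h2 h5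
      linarith) h3
    linarith

omit hθ' hθ in
theorem sum_edgeGain_le_left (j : ℤ) (N : ℕ) {e : ℝ} (h1 : dir θ a (j + N) ≤ e)
    (h2 : dir θ a (j + N) = e → a (j + N) = 0) (h3 : e - dir θ a j < π) :
    ∑ i ∈ Finset.range N, edgeGain θ a (j + i) ≤
      sin (a (j + N)) ^ 2 * cot (e - dir θ a (j + N)) - sin (a j) ^ 2 * cot (e - dir θ a j) := by
  induction N with
  | zero => simp
  | succ N ih =>
    have e3 : j + ((N + 1 : ℕ) : ℤ) = j + N + 1 := by push_cast; ring
    rw [e3] at h1 h2 ⊢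
    have hle := dir_le_dir_succ ha (j + N)
    have hm : dir θ a j ≤ dir θ a (j + N) := dir_mono ha (by omega)
    have hj := edgeGain_le_cot' ha (j + N) h1 h2 (by linarith)
    rw [Finset.sum_range_succ]
    have := ih (by linarith) (fun h => by
      have h5 : dir θ a (j + N + 1) = e := by linarith
      have h6 := dir_succ θ a (j + N)
      have := abs_le.1 (ha (j + N))
      have := abs_le.1 (ha (j + N + 1))
      have := h2 h5
      linarith)
    linarith

end

theorem sin_sq_mul_tan_end_le {θ u a : ℝ} (hθ : 0 < θ) (hθ' : 3 * θ < π / 2) (hu : -θ ≤ u)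
    (hu' : u ≤ 2 * θ) (ha : |a| ≤ θ) (h : u ≤ θ ∨ 0 ≤ a) :
    sin a ^ 2 * tan (θ + a) + sin a ^ 2 * tan (u - a) ≤
      sin θ ^ 2 * (tan (2 * θ) + tan (u - θ)) := by
  obtain ⟨ha1, ha2⟩ := abs_le.1 ha
  have h1 : 0 < cos (θ + a) := cos_pos_of_mem_Ioo ⟨by linarith, by linarith⟩
  have h2 : 0 < cos (u - a) := cos_pos_of_mem_Ioo ⟨by linarith, by linarith⟩
  have h3 : 0 < cos (2 * θ) := cos_pos_of_mem_Ioo ⟨by linarith, by linarith⟩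
  have h4 : 0 < cos (u - θ) := cos_pos_of_mem_Ioo ⟨by linarith, by linarith⟩
  have h5 : 0 < cos u := cos_pos_of_mem_Ioo ⟨by linarith, by linarith⟩
  have hs : 0 < sin θ := sin_pos_of_pos_of_lt_pi (by linarith) (by linarith)
  have hc : 0 < cos θ := cos_pos_of_mem_Ioo ⟨by linarith, by linarith⟩
  have hS : 0 ≤ sin (θ + u) := sin_nonneg_of_nonneg_of_le_pi (by linarith) (by linarith)
  have e1 : sin a ^ 2 * tan (θ + a) + sin a ^ 2 * tan (u - a) =
      sin (θ + u) * ((sin a / cos (θ + a)) * (sin a / cos (u - a))) := by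
    rw [show θ + u = (θ + a) + (u - a) by ring, sin_add (θ + a), tan_eq_sin_div_cos,
      tan_eq_sin_div_cos]
    field_simp
  have e2 : sin θ ^ 2 * (tan (2 * θ) + tan (u - θ)) =
      sin (θ + u) * ((sin θ / cos (2 * θ)) * (sin θ / cos (u - θ))) := by
    rw [show θ + u = 2 * θ + (u - θ) by ring, sin_add (2 * θ), tan_eq_sin_div_cos,
      tan_eq_sin_div_cos]
    field_simp
  rw [e1, e2]
  apply mul_le_mul_of_nonneg_left _ hS
  rcases le_total 0 a with h0 | h0
  · have hsa : 0 ≤ sin a := sin_nonneg_of_nonneg_of_le_pi h0 (by linarith)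
    apply mul_le_mul _ _ (by positivity) (by positivity)
    · apply div_le_div₀ hs.le _ h3
      · exact cos_le_cos_of_nonneg_of_le_pi (by linarith) (by linarith) (by linarith)
      · exact sin_le_sin_of_le_of_le_pi_div_two (by linarith) (by linarith) ha2
    · rw [div_le_div_iff₀ h2 h4]
      have : sin θ * cos (u - a) - sin a * cos (u - θ) = cos u * sin (θ - a) := by
        simp only [cos_sub, sin_sub]; ring
      have : 0 ≤ sin (θ - a) := sin_nonneg_of_nonneg_of_le_pi (by linarith) (by linarith)
      nlinarith
  · rcases eq_or_lt_of_le h0 with h0' | h0'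
    · rw [h0']; simp; positivity
    have hu1 : u ≤ θ := h.resolve_right (by linarith)
    obtain ⟨b, rfl⟩ : ∃ b, a = -b := ⟨-a, by ring⟩
    have h6 : 0 < cos (u + θ) := cos_pos_of_mem_Ioo ⟨by linarith, by linarith⟩
    have hsb : 0 ≤ sin b := sin_nonneg_of_nonneg_of_le_pi (by linarith) (by linarith)
    have hd : 0 ≤ sin (θ - b) := sin_nonneg_of_nonneg_of_le_pi (by linarith) (by linarith)
    rw [sin_neg]
    calc -sin b / cos (θ + -b) * (-sin b / cos (u - -b))
        = (sin b / cos (θ + -b)) * (sin b / cos (u - -b)) := by ring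
      _ ≤ sin θ * (sin θ / cos (u + θ)) := by
        apply mul_le_mul _ _ (by positivity) (by positivity)
        · rw [div_le_iff₀ h1]
          have : sin θ * cos (θ + -b) - sin b = cos θ * sin (θ - b) := by
            rw [← sub_eq_add_neg]
            simp only [cos_sub, sin_sub]
            have := sin_sq_add_cos_sq θ
            grind
          nlinarith
        · rw [div_le_div_iff₀ h2 h6]
          have : sin θ * cos (u - -b) - sin b * cos (u + θ) = cos u * sin (θ - b) := by
            rw [sub_neg_eq_add]
            simp only [cos_add, sin_sub]; ring
          nlinarith
      _ = sin θ ^ 2 / cos (u + θ) := by ring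
      _ ≤ sin θ ^ 2 / (cos (2 * θ) * cos (u - θ)) := by
        apply div_le_div_of_nonneg_left (by positivity) (by positivity)
        have : cos (u + θ) = cos (2 * θ) * cos (u - θ) - sin (2 * θ) * sin (u - θ) := by
          rw [← cos_add]; ring_nf
        have : 0 ≤ sin (2 * θ) := sin_nonneg_of_nonneg_of_le_pi (by linarith) (by linarith)
        have : sin (u - θ) ≤ 0 := sin_nonpos_of_nonpos_of_neg_pi_le (by linarith) (by linarith)
        nlinarith
      _ = _ := by field_simp

theorem two_mul_tan_half_le {x y : ℝ} (hx : |x| < π / 2) (hy : |y| < π / 2) (h : 0 ≤ x + y) :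
    2 * tan ((x + y) / 2) ≤ tan x + tan y := by
  obtain ⟨hx1, hx2⟩ := abs_lt.1 hx
  obtain ⟨hy1, hy2⟩ := abs_lt.1 hy
  have h1 : 0 < cos x := cos_pos_of_mem_Ioo ⟨by linarith, by linarith⟩
  have h2 : 0 < cos y := cos_pos_of_mem_Ioo ⟨by linarith, by linarith⟩
  have h3 : 0 < cos ((x + y) / 2) := cos_pos_of_mem_Ioo ⟨by linarith, by linarith⟩
  have hS : 0 ≤ sin (x + y) := sin_nonneg_of_nonneg_of_le_pi (by linarith) (by linarith)
  have e1 : tan x + tan y = sin (x + y) / (cos x * cos y) := by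
    rw [sin_add, tan_eq_sin_div_cos, tan_eq_sin_div_cos]; field_simp
  have e2 : 2 * tan ((x + y) / 2) = sin (x + y) / cos ((x + y) / 2) ^ 2 := by
    rw [show sin (x + y) = sin (2 * ((x + y) / 2)) by ring_nf, sin_two_mul, tan_eq_sin_div_cos]
    field_simp
  rw [e1, e2]
  apply div_le_div_of_nonneg_left hS (by positivity)
  have e3 : cos x * cos y = cos ((x + y) / 2) ^ 2 - sin ((x - y) / 2) ^ 2 := by
    have h4 : x = (x + y) / 2 + (x - y) / 2 := by ring
    have h5 : y = (x + y) / 2 - (x - y) / 2 := by ring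
    generalize (x + y) / 2 = p at *
    generalize (x - y) / 2 = q at *
    rw [h4, h5, cos_add, cos_sub]
    have := sin_sq_add_cos_sq p
    have := sin_sq_add_cos_sq q
    grind
  nlinarith [sq_nonneg (sin ((x - y) / 2))]

/-- The edge from vertex `k` to vertex `k + 1` has a node at direction `e`. -/
structure IsNode (θ : ℝ) (a : ℤ → ℝ) (k : ℤ) (e : ℝ) : Prop where
  dir_le : dir θ a k ≤ e
  le_dir : e ≤ dir θ a (k + 1)
  eq_zero_left : dir θ a k = e → a k = 0
  eq_zero_right : dir θ a (k + 1) = e → a (k + 1) = 0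
  edgeGain_le : edgeGain θ a k ≤ -sin (a k) ^ 2 * cot (e - dir θ a k)
    - sin (a (k + 1)) ^ 2 * cot (dir θ a (k + 1) - e)

theorem eq_zero_of_sin_eq_zero {θ a : ℝ} (hθ' : θ < π / 4) (ha : |a| ≤ θ) (h : sin a = 0) :
    a = 0 := by
  obtain ⟨ha1, ha2⟩ := abs_le.1 ha
  exact (sin_eq_zero_iff_of_lt_of_lt (by linarith) (by linarith)).1 h

theorem exists_isNode {θ : ℝ} {a : ℤ → ℝ} (hθ : 0 < θ) (hθ' : θ < π / 4) (ha : ∀ k, |a k| ≤ θ)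
    {k : ℤ} (h : 0 ≤ a k * a (k + 1)) : ∃ e, IsNode θ a k e := by
  have hd := dir_succ θ a k
  obtain ⟨h1, h2⟩ := abs_le.1 (ha k)
  obtain ⟨h3, h4⟩ := abs_le.1 (ha (k + 1))
  set τ := 2 * θ + a k - a (k + 1) with hτdef
  have hτ : 0 < τ ∧ τ < π := by
    rcases mul_nonneg_iff.1 h with ⟨h5, h6⟩ | ⟨h5, h6⟩ <;> constructor <;> linarith
  have hs : 0 < sin τ := sin_pos_of_pos_of_lt_pi hτ.1 hτ.2
  have hpq : |sin (a k)| * |sin (a (k + 1))| = sin (a k) * sin (a (k + 1)) := by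
    rw [← abs_mul, abs_of_nonneg]
    rcases mul_nonneg_iff.1 h with ⟨h5, h6⟩ | ⟨h5, h6⟩
    · exact mul_nonneg (sin_nonneg_of_nonneg_of_le_pi h5 (by linarith))
        (sin_nonneg_of_nonneg_of_le_pi h6 (by linarith))
    · exact mul_nonneg_of_nonpos_of_nonpos (sin_nonpos_of_nonpos_of_neg_pi_le h5 (by linarith))
        (sin_nonpos_of_nonpos_of_neg_pi_le h6 (by linarith))
  have hg : edgeGain θ a k = -((sin (a k) ^ 2 + sin (a (k + 1)) ^ 2) * cos τ
      + 2 * (sin (a k) * sin (a (k + 1)))) / sin τ := by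
    unfold edgeGain gain; rw [← hτdef]; ring
  rw [← hpq, ← sq_abs (sin (a k)), ← sq_abs (sin (a (k + 1)))] at hg
  have hp0 : |sin (a k)| = 0 → a k = 0 := fun h0 =>
    eq_zero_of_sin_eq_zero hθ' (ha k) (abs_eq_zero.1 h0)
  have hq0 : |sin (a (k + 1))| = 0 → a (k + 1) = 0 := fun h0 =>
    eq_zero_of_sin_eq_zero hθ' (ha (k + 1)) (abs_eq_zero.1 h0)
  have hp : 0 ≤ |sin (a k)| := abs_nonneg _
  have hq : 0 ≤ |sin (a (k + 1))| := abs_nonneg _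
  have key : ∃ t, 0 ≤ t ∧ t ≤ τ ∧ |sin (a k)| * sin (τ - t) - |sin (a (k + 1))| * sin t = 0 := by
    have hcont : ContinuousOn (fun t => |sin (a k)| * sin (τ - t) - |sin (a (k + 1))| * sin t)
      (Set.Icc 0 τ) := by fun_prop
    obtain ⟨t, ht, h0⟩ := intermediate_value_Icc' hτ.1.le hcont
      (show (0 : ℝ) ∈ _ by simp; constructor <;> positivity)
    exact ⟨t, ht.1, ht.2, h0⟩
  obtain ⟨t, ht0, htτ, ht⟩ := key
  have hA : t = 0 → |sin (a k)| = 0 := by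
    rintro rfl; simp at ht; simpa [hs.ne'] using ht
  have hB : t = τ → |sin (a (k + 1))| = 0 := by
    rintro rfl; simp at ht; simpa [hs.ne'] using ht
  refine ⟨dir θ a k + t, by linarith, by linarith, fun h0 => hp0 (hA (by linarith)),
    fun h0 => hq0 (hB (by linarith)), ?_⟩
  rw [show dir θ a k + t - dir θ a k = t by ring,
    show dir θ a (k + 1) - (dir θ a k + t) = τ - t by linarith, hg, ← sq_abs (sin (a k)),
    ← sq_abs (sin (a (k + 1)))]
  clear_value τ
  generalize |sin (a k)| = p at *
  generalize |sin (a (k + 1))| = q at *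
  rw [cot_eq_cos_div_sin, cot_eq_cos_div_sin]
  apply le_of_eq
  rcases eq_or_lt_of_le ht0 with h0 | h0
  · rw [hA h0.symm, ← h0]; simp; ring
  rcases eq_or_lt_of_le htτ with h00 | h00
  · rw [hB h00, ← h00]; simp; ring
  have hs1 : 0 < sin t := sin_pos_of_pos_of_lt_pi h0 (by linarith)
  have hs2 : 0 < sin (τ - t) := sin_pos_of_pos_of_lt_pi (by linarith) (by linarith)
  have e : τ = t + (τ - t) := by ring
  generalize τ - t = v at *
  subst e
  have h5 := sin_sq_add_cos_sq t
  have h6 := sin_sq_add_cos_sq v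
  field_simp
  simp only [sin_add, cos_add]
  grind

theorem mul_pos_of_alternating {a : ℤ → ℝ} (j : ℤ) (N : ℕ)
    (h : ∀ i : ℕ, i < 2 * N → a (j + i) * a (j + i + 1) < 0) (hj : a j ≠ 0) :
    0 < a j * a (j + 2 * N) := by
  induction N with
  | zero => simpa using mul_self_pos.2 hj
  | succ N ih =>
    have h1 := ih (fun i hi => h i (by omega))
    have h2 := h (2 * N) (by omega)
    have h3 := h (2 * N + 1) (by omega)
    push_cast at h2 h3 ⊢
    rw [show j + (2 * (N : ℤ) + 1) = j + 2 * N + 1 by ring,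
      show j + 2 * (N : ℤ) + 1 + 1 = j + 2 * (N + 1) by ring] at h3
    generalize a (j + 2 * (N : ℤ) + 1) = y at *
    generalize a (j + 2 * (N : ℤ)) = x at *
    generalize a (j + 2 * ((N : ℤ) + 1)) = z at *
    have h4 : 0 < x * z := by
      have := mul_pos_of_neg_of_neg h2 h3
      by_contra h5
      nlinarith [sq_nonneg y]
    by_contra h5
    nlinarith [sq_nonneg x, mul_pos h1 h4]

theorem exists_mul_nonneg_of_periodic {a : ℤ → ℝ} (N : ℕ) (h : ∀ k, a (k + (2 * N + 1)) = a k) :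
    ∃ k, 0 ≤ a k * a (k + 1) := by
  by_contra! hc
  have h0 := hc 0
  have h1 := mul_pos_of_alternating 0 N (fun i _ => hc _) (fun h => by simp [h] at h0)
  have h2 := hc (2 * N)
  have h3 := h 0
  simp only [zero_add] at *
  rw [h3] at h2
  linarith

theorem exists_mul_nonneg_of_neg_of_pos {a : ℤ → ℝ} (j : ℤ) (N : ℕ) (h1 : a j < 0)
    (h2 : 0 < a (j + 2 * N)) : ∃ i : ℕ, i < 2 * N ∧ 0 ≤ a (j + i) * a (j + i + 1) := by
  by_contra! hc
  have := mul_pos_of_alternating j N hc h1.ne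
  nlinarith

theorem sum_range_add_int (f : ℤ → ℝ) (L : ℤ) (p q : ℕ) :
    ∑ i ∈ Finset.range (p + q), f (L + i) =
      ∑ i ∈ Finset.range p, f (L + i) + ∑ i ∈ Finset.range q, f (L + p + i) := by
  rw [Finset.sum_range_add]
  congr 1
  exact Finset.sum_congr rfl fun i _ => by push_cast; ring_nf

theorem sum_range_periodic {f : ℤ → ℝ} {n : ℕ} (hf : ∀ k, f (k + n) = f k) (L : ℤ) :
    ∑ i ∈ Finset.range n, f (L + i) = ∑ i ∈ Finset.range n, f i := by
  have step : ∀ L : ℤ, ∑ i ∈ Finset.range n, f (L + 1 + i) = ∑ i ∈ Finset.range n, f (L + i) := by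
    intro L
    have h1 := sum_range_add_int f L 1 n
    have h2 := sum_range_add_int f L n 1
    rw [add_comm 1 n, h2] at h1
    simp [hf] at h1
    linarith
  induction L using Int.induction_on with
  | zero => simp
  | succ L ih => rw [step, ih]
  | pred L ih => rw [← ih, ← step, sub_add_cancel]

theorem cot_pi_div_two_add (x : ℝ) : cot (π / 2 + x) = -tan x := by
  rw [cot_eq_cos_div_sin, tan_eq_sin_div_cos, add_comm, cos_add_pi_div_two, sin_add_pi_div_two]
  ring

theorem cot_le_cot_of_le {x y : ℝ} (hx : 0 < x) (hy : y < π) (h : x ≤ y) : cot y ≤ cot x := by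
  have h1 : 0 < sin x := sin_pos_of_pos_of_lt_pi hx (by linarith)
  have h2 : 0 < sin y := sin_pos_of_pos_of_lt_pi (by linarith) hy
  rw [cot_eq_cos_div_sin, cot_eq_cos_div_sin, div_le_div_iff₀ h2 h1]
  have : 0 ≤ sin (y - x) := sin_nonneg_of_nonneg_of_le_pi (by linarith) (by linarith)
  rw [sin_sub] at this
  linarith

theorem cot_add_cot_nonneg {x y : ℝ} (hx : 0 < x) (hy : 0 < y) (h : x + y ≤ π) :
    0 ≤ cot x + cot y := by
  have h1 : 0 < sin x := sin_pos_of_pos_of_lt_pi hx (by linarith)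
  have h2 : 0 < sin y := sin_pos_of_pos_of_lt_pi hy (by linarith)
  have h3 : 0 ≤ sin (x + y) := sin_nonneg_of_nonneg_of_le_pi (by linarith) h
  have : cot x + cot y = sin (x + y) / (sin x * sin y) := by
    rw [cot_eq_cos_div_sin, cot_eq_cos_div_sin, sin_add]; field_simp; ring
  rw [this]; positivity

section
variable {θ : ℝ} {a : ℤ → ℝ} {m : ℕ} (hm : 1 ≤ m) (hθ : 0 < θ) (hπ : (4 * m + 3) * θ = π)
  (ha : ∀ k, |a k| ≤ θ) (hper : ∀ k, a (k + (4 * m + 3)) = a k)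

include hm hθ hπ in
theorem seven_mul_le_pi : 7 * θ ≤ π := by
  have : (1 : ℝ) ≤ m := by exact_mod_cast hm
  nlinarith

include hm hθ hπ ha hper

theorem sum_edgeGain_le_of_window {k : ℤ} {e : ℝ} (hk : IsNode θ a k e) (c : ℤ)
    (h1 : |2 * θ * c - e| ≤ 3 / 2 * θ)
    (h2 : 2 * θ * c - e ≤ θ / 2 ∨ 0 ≤ a (c + m + 1))
    (h3 : -(θ / 2) ≤ 2 * θ * c - e ∨ a (c - m - 1) ≤ 0) :
    ∑ i ∈ Finset.range (4 * m + 3), edgeGain θ a (c - m - 1 + i) ≤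
      sin θ ^ 2 * ((2 * m + 2) * tan (2 * θ) - 2 * tan (θ / 2)) := by
  have h7 := seven_mul_le_pi hm hθ hπ
  have hm' : (1 : ℝ) ≤ m := by exact_mod_cast hm
  obtain ⟨h1l, h1r⟩ := abs_le.1 h1
  have hθ4 : θ < π / 4 := by linarith
  have A1 := abs_le.1 (ha k)
  have A2 := abs_le.1 (ha (k + 1))
  have AR := abs_le.1 (ha (c + m + 1))
  have AL := abs_le.1 (ha (c - m - 1))
  have hLk : c - m - 1 ≤ k := by
    have := hk.le_dir
    unfold dir at this
    push_cast at this
    have h : (2 * c : ℝ) < 2 * k + 5 := by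
      by_contra! hc
      nlinarith
    have : 2 * c < 2 * k + 5 := by exact_mod_cast h
    omega
  have hkR : k + 1 ≤ c + m + 1 := by
    have := hk.dir_le
    unfold dir at this
    have h : (2 * k : ℝ) < 2 * c + 3 := by
      by_contra! hc
      nlinarith
    have : 2 * k < 2 * c + 3 := by exact_mod_cast h
    omega
  obtain ⟨p, hp⟩ := Int.le.dest hLk
  obtain ⟨q, hq⟩ := Int.le.dest hkR
  have hpq : p + 1 + q + (2 * m + 1) = 4 * m + 3 := by omega
  have eL : c + m + 1 + ((2 * m : ℕ) : ℤ) + 1 = c - m - 1 + (4 * m + 3) := by push_cast; ring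
  have s1 := sum_edgeGain_le_left ha (c - m - 1) p (e := e) (by rw [hp]; exact hk.dir_le)
    (by rw [hp]; exact hk.eq_zero_left) (by unfold dir; push_cast; nlinarith)
  have s2 := hk.edgeGain_le
  have s3 := sum_edgeGain_le_right ha (k + 1) q hk.le_dir hk.eq_zero_right
    (by rw [hq]; unfold dir; push_cast; nlinarith)
  have s4 := sum_edgeGain_le_outer hθ hθ4 ha (c + m + 1) (2 * m)
  rw [hp] at s1
  rw [hq] at s3
  rw [eL, hper] at s4
  rw [← hpq, sum_range_add_int, sum_range_add_int, sum_range_add_int]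
  push_cast
  rw [show c - m - 1 + ((p : ℤ) + 1 + q) = c + m + 1 by omega,
    show c - m - 1 + ((p : ℤ) + 1) = k + 1 by omega, hp]
  have c1 : dir θ a (c + m + 1) - e = π / 2 + ((θ / 2 + (2 * θ * c - e)) - a (c + m + 1)) := by
    unfold dir; push_cast; linarith
  have c2 : e - dir θ a (c - m - 1) = π / 2 + ((θ / 2 - (2 * θ * c - e)) - -a (c - m - 1)) := by
    unfold dir; push_cast; linarith
  rw [c1, cot_pi_div_two_add] at s3
  rw [c2, cot_pi_div_two_add] at s1
  set δ := 2 * θ * c - e with hδ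
  have e1 := sin_sq_mul_tan_end_le (u := θ / 2 + δ) hθ (by linarith) (by linarith) (by linarith)
    (ha (c + m + 1)) (h2.imp (fun h => by linarith) id)
  have e2 := sin_sq_mul_tan_end_le (u := θ / 2 - δ) (a := -a (c - m - 1)) hθ (by linarith)
    (by linarith) (by linarith) (by rw [abs_neg]; exact ha _)
    (h3.imp (fun h => by linarith) (fun h => by linarith))
  have e3 := two_mul_tan_half_le (x := θ / 2 - δ) (y := θ / 2 + δ)
    (abs_lt.2 ⟨by linarith, by linarith⟩) (abs_lt.2 ⟨by linarith, by linarith⟩) (by linarith)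
  rw [show θ / 2 + δ - θ = -(θ / 2 - δ) by ring, tan_neg] at e1
  rw [show θ / 2 - δ - θ = -(θ / 2 + δ) by ring, tan_neg, sin_neg, neg_sq] at e2
  rw [show (θ / 2 - δ + (θ / 2 + δ)) / 2 = θ / 2 by ring] at e3
  rw [← sub_eq_add_neg] at e2
  have e4 := mul_le_mul_of_nonneg_left e3 (sq_nonneg (sin θ))
  simp only [Finset.sum_range_one, Nat.cast_zero, add_zero]
  push_cast at s4
  linarith

theorem sum_edgeGain_le_of_nodes {k k' : ℤ} {e e' : ℝ} (hk : IsNode θ a k e)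
    (hk' : IsNode θ a k' e') (h1 : π / 2 + θ ≤ e' - e) (h2 : e' - e ≤ π) :
    ∑ i ∈ Finset.range (4 * m + 3), edgeGain θ a i ≤
      (2 * m + 1) * (sin θ ^ 2 * tan (2 * θ)) := by
  have h7 := seven_mul_le_pi hm hθ hπ
  have hm' : (1 : ℝ) ≤ m := by exact_mod_cast hm
  have hθ4 : θ < π / 4 := by linarith
  have round : ∀ x : ℝ, ∃ j : ℤ, x < 2 * θ * j ∧ 2 * θ * j ≤ x + 2 * θ := by
    intro x
    refine ⟨⌊x / (2 * θ)⌋ + 1, ?_, ?_⟩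
    · have := Int.lt_floor_add_one (x / (2 * θ))
      rw [div_lt_iff₀ (by linarith)] at this
      push_cast; linarith
    · have := Int.floor_le (x / (2 * θ))
      rw [le_div_iff₀ (by linarith)] at this
      push_cast; linarith
  obtain ⟨j, hj1, hj2⟩ := round (e + θ)
  obtain ⟨R, hR1, hR2⟩ := round (e' + 2 * m * θ)
  obtain ⟨L', hL1, hL2⟩ := round (-e + 2 * m * θ)
  obtain ⟨L, rfl⟩ : ∃ L, L' = -L := ⟨-L', by ring⟩
  push_cast at hL1 hL2
  have A1 := abs_le.1 (ha k)
  have A2 := abs_le.1 (ha (k + 1))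
  have A1' := abs_le.1 (ha k')
  have A2' := abs_le.1 (ha (k' + 1))
  have AR := abs_le.1 (ha R)
  have AL := abs_le.1 (ha L)
  have AJ := abs_le.1 (ha j)
  have d1 := hk.le_dir
  have d2 := hk.dir_le
  have d3 := hk'.le_dir
  have d4 := hk'.dir_le
  unfold dir at d1 d2 d3 d4
  push_cast at d1 d2 d3 d4
  have cancel : ∀ {x y : ℤ}, 2 * θ * x < 2 * θ * (y + 1) → x ≤ y := by
    intro x y h
    have : (x : ℝ) < y + 1 := lt_of_mul_lt_mul_left h (by linarith)
    have : x < y + 1 := by exact_mod_cast this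
    omega
  have hmθ : θ ≤ m * θ := by nlinarith
  have hLk : L ≤ k := cancel (by linarith)
  have hkj : k + 1 ≤ j := cancel (by push_cast; linarith)
  have hjk : j ≤ k' := cancel (by linarith)
  have hkR : k' + 1 ≤ R := cancel (by push_cast; linarith)
  have hRL : R ≤ L + (4 * m + 3) := cancel (by push_cast; linarith)
  have hRL' : L + (2 * m + 3) ≤ R := cancel (by push_cast; linarith)
  obtain ⟨p, hp⟩ := Int.le.dest hLk
  obtain ⟨q, hq⟩ := Int.le.dest hkj
  obtain ⟨p', hp'⟩ := Int.le.dest hjk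
  obtain ⟨q', hq'⟩ := Int.le.dest hkR
  obtain ⟨N, hN⟩ := Int.le.dest hRL
  have hsum : p + 1 + q + p' + 1 + q' + N = 4 * m + 3 := by omega
  have hNle : N ≤ 2 * m := by omega
  have s1 := sum_edgeGain_le_left ha L p (e := e) (by rw [hp]; exact hk.dir_le)
    (by rw [hp]; exact hk.eq_zero_left) (by unfold dir; linarith)
  have s2 := hk.edgeGain_le
  have s3 := sum_edgeGain_le_right ha (k + 1) q hk.le_dir hk.eq_zero_right
    (by rw [hq]; unfold dir; linarith)
  have s4 := sum_edgeGain_le_left ha j p' (e := e') (by rw [hp']; exact hk'.dir_le)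
    (by rw [hp']; exact hk'.eq_zero_left) (by unfold dir; linarith)
  have s5 := hk'.edgeGain_le
  have s6 := sum_edgeGain_le_right ha (k' + 1) q' hk'.le_dir hk'.eq_zero_right
    (by rw [hq']; unfold dir; linarith)
  have s7 := sum_edgeGain_le_of_start hθ hθ4 ha R N
  have e1 := sin_sq_mul_tan_add_le hθ hθ4 (ha L)
  have f1 : cot (π / 2 + (θ - a R)) ≤ cot (dir θ a R - e') := by
    unfold dir; apply cot_le_cot_of_le <;> linarith
  have f2 : cot (π / 2 + (θ + a L)) ≤ cot (e - dir θ a L) := by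
    unfold dir; apply cot_le_cot_of_le <;> linarith
  have f3 : 0 ≤ cot (dir θ a j - e) + cot (e' - dir θ a j) := by
    unfold dir; apply cot_add_cot_nonneg <;> linarith
  rw [cot_pi_div_two_add] at f1 f2
  have g1 := mul_le_mul_of_nonneg_left f1 (sq_nonneg (sin (a R)))
  have g2 := mul_le_mul_of_nonneg_left f2 (sq_nonneg (sin (a L)))
  have g3 := mul_nonneg (sq_nonneg (sin (a j))) f3
  rw [hp] at s1
  rw [hq] at s3
  rw [hp'] at s4
  rw [hq'] at s6
  rw [hN, hper] at s7
  have hperG : ∀ k : ℤ, edgeGain θ a (k + ((4 * m + 3 : ℕ) : ℤ)) = edgeGain θ a k := by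
    intro k
    unfold edgeGain
    push_cast
    rw [hper, show k + (4 * (m : ℤ) + 3) + 1 = k + 1 + (4 * m + 3) by ring, hper]
  rw [← sum_range_periodic hperG L, ← hsum]
  simp only [sum_range_add_int]
  push_cast
  rw [show L + (p + 1 + q + p' + 1 + q') = R by omega,
    show L + (p + 1 + q + p' + 1) = k' + 1 by omega,
    show L + (p + 1 + q + p') = k' by omega, show L + (p + 1 + q) = j by omega,
    show L + ((p : ℤ) + 1) = k + 1 by omega, hp]
  have hT : 0 ≤ sin θ ^ 2 * tan (2 * θ) :=
    mul_nonneg (sq_nonneg _) (tan_nonneg_of_nonneg_of_le_pi_div_two (by linarith) (by linarith))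
  have hN' : (N : ℝ) ≤ 2 * m := by exact_mod_cast hNle
  have g4 := mul_le_mul_of_nonneg_right hN' hT
  simp only [Finset.sum_range_one, Nat.cast_zero, add_zero]
  linarith

end

theorem sum_edgeGain_le {θ : ℝ} {a : ℤ → ℝ} {m : ℕ} (hm : 1 ≤ m) (hθ : 0 < θ)
    (hπ : (4 * m + 3) * θ = π) (ha : ∀ k, |a k| ≤ θ) (hper : ∀ k, a (k + (4 * m + 3)) = a k) :
    ∑ i ∈ Finset.range (4 * m + 3), edgeGain θ a i ≤
      sin θ ^ 2 * ((2 * m + 2) * tan (2 * θ) - 2 * tan (θ / 2)) := by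
  have h7 := seven_mul_le_pi hm hθ hπ
  have hperG : ∀ k : ℤ, edgeGain θ a (k + ((4 * m + 3 : ℕ) : ℤ)) = edgeGain θ a k := by
    intro k
    unfold edgeGain
    push_cast
    rw [hper, show k + (4 * (m : ℤ) + 3) + 1 = k + 1 + (4 * m + 3) by ring, hper]
  have hdir : ∀ k : ℤ, dir θ a (k + (4 * m + 3)) = dir θ a k + 2 * π := by
    intro k
    unfold dir
    rw [hper]; push_cast; linarith
  obtain ⟨k, hk0⟩ := exists_mul_nonneg_of_periodic (a := a) (2 * m + 1) (fun k => by
    rw [← hper k]; push_cast; ring_nf)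
  obtain ⟨e, hk⟩ := exists_isNode hθ (by linarith) ha hk0
  obtain ⟨c, hc1, hc2⟩ : ∃ c : ℤ, 2 * θ * c ≤ e + θ / 2 ∧ e + θ / 2 < 2 * θ * (c + 1) := by
    refine ⟨⌊(e + θ / 2) / (2 * θ)⌋, ?_, ?_⟩
    · have := Int.floor_le ((e + θ / 2) / (2 * θ))
      rw [le_div_iff₀ (by linarith)] at this
      linarith
    · have := Int.lt_floor_add_one ((e + θ / 2) / (2 * θ))
      rw [div_lt_iff₀ (by linarith)] at this
      linarith
  rcases le_or_gt (e - 2 * θ * c) (θ / 2) with h1 | h1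
  · rw [← sum_range_periodic hperG (c - m - 1)]
    exact sum_edgeGain_le_of_window hm hθ hπ ha hper hk c
      (abs_le.2 ⟨by linarith, by linarith⟩) (Or.inl (by linarith)) (Or.inl (by linarith))
  rcases le_or_gt 0 (a (c + 1 + m + 1)) with h2 | h2
  · rw [← sum_range_periodic hperG (c + 1 - m - 1)]
    exact sum_edgeGain_le_of_window hm hθ hπ ha hper hk (c + 1)
      (abs_le.2 ⟨by push_cast; linarith, by push_cast; linarith⟩) (Or.inr h2)
      (Or.inl (by push_cast; linarith))
  rcases le_or_gt (a (c - m - 1)) 0 with h3 | h3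
  · rw [← sum_range_periodic hperG (c - m - 1)]
    exact sum_edgeGain_le_of_window hm hθ hπ ha hper hk c
      (abs_le.2 ⟨by linarith, by linarith⟩) (Or.inl (by linarith)) (Or.inr h3)
  have h3' : 0 < a (c + 1 + m + 1 + 2 * m) := by
    rw [show c + 1 + m + 1 + 2 * (m : ℤ) = c - m - 1 + (4 * m + 3) by ring, hper]
    exact h3
  obtain ⟨i, hi, hi0⟩ := exists_mul_nonneg_of_neg_of_pos (c + 1 + m + 1) m h2 h3'
  obtain ⟨e', hk'⟩ := exists_isNode hθ (by linarith) ha hi0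
  have hmono := dir_mono ha
  have d1 : dir θ a (c + 1 + m + 1) ≤ e' := (hmono (by omega)).trans hk'.dir_le
  have d2 : e' ≤ dir θ a (c + 1 + m + 1 + 2 * m) := hk'.le_dir.trans (hmono (by omega))
  unfold dir at d1 d2
  push_cast at d1 d2
  have hlow : π / 2 + θ ≤ e' - e := by linarith
  have hhigh : e' - e ≤ 3 / 2 * π - θ := by linarith
  have hS : (2 * m + 1) * (sin θ ^ 2 * tan (2 * θ)) ≤
      sin θ ^ 2 * ((2 * m + 2) * tan (2 * θ) - 2 * tan (θ / 2)) := by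
    have h4 : 2 * tan (θ / 2) ≤ tan θ := by
      have := two_mul_tan_half_le (x := 0) (y := θ) (by simp; positivity)
        (abs_lt.2 ⟨by linarith, by linarith⟩) (by linarith)
      simpa using this
    have h5 : tan θ ≤ tan (2 * θ) :=
      (tan_lt_tan_of_lt_of_lt_pi_div_two (by linarith) (by linarith) (by linarith)).le
    nlinarith [sq_nonneg (sin θ)]
  refine le_trans ?_ hS
  rcases le_total (e' - e) π with h4 | h4
  · exact sum_edgeGain_le_of_nodes hm hθ hπ ha hper hk hk' hlow h4
  · have hk2 : IsNode θ a (k + (4 * m + 3)) (e + 2 * π) := by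
      have e1 : k + (4 * (m : ℤ) + 3) + 1 = k + 1 + (4 * m + 3) := by ring
      constructor
      · rw [hdir]; linarith [hk.dir_le]
      · rw [e1, hdir]; linarith [hk.le_dir]
      · rw [hdir, hper]; exact fun h => hk.eq_zero_left (by linarith)
      · rw [e1, hdir, hper]; exact fun h => hk.eq_zero_right (by linarith)
      · have := hperG k
        push_cast at this
        rw [this, e1, hper, hper, hdir, hdir, add_sub_add_right_eq_sub, add_sub_add_right_eq_sub]
        exact hk.edgeGain_le
    exact sum_edgeGain_le_of_nodes hm hθ hπ ha hper hk' hk2 (by linarith) (by linarith)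

/-- The slope angle at `y` for an oscillation with amplitude `z`. -/
def waveAngle (z y : ℝ) : ℝ := arctan (z * sin y / (1 + z * cos y))

theorem one_add_mul_cos_pos {z y : ℝ} (hz : |z| < 1) : 0 < 1 + z * cos y := by
  have := abs_cos_le_one y
  have h : |z * cos y| < 1 := by
    rw [abs_mul]; nlinarith [abs_nonneg z, abs_nonneg (cos y)]
  linarith [(abs_lt.1 h).1]

theorem sin_waveAngle {z y : ℝ} (hz : |z| < 1) :
    sin (waveAngle z y) = z * sin (y - waveAngle z y) := by
  have h1 := one_add_mul_cos_pos hz (y := y)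
  have h2 : 0 < cos (waveAngle z y) := cos_arctan_pos _
  have h3 : tan (waveAngle z y) = z * sin y / (1 + z * cos y) := tan_arctan _
  rw [tan_eq_sin_div_cos, div_eq_div_iff h2.ne' h1.ne'] at h3
  rw [sin_sub]
  linear_combination h3

theorem abs_waveAngle_le {θ z y : ℝ} (hθ : 0 < θ) (hθ' : θ < π / 2) (hz : |z| < 1)
    (h1 : |z * sin (y - θ)| ≤ sin θ) (h2 : |z * sin (y + θ)| ≤ sin θ) :
    |waveAngle z y| ≤ θ := by
  have hp := one_add_mul_cos_pos hz (y := y)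
  have hc : 0 < cos θ := cos_pos_of_mem_Ioo ⟨by linarith, by linarith⟩
  obtain ⟨h1l, h1r⟩ := abs_le.1 h1
  obtain ⟨h2l, h2r⟩ := abs_le.1 h2
  rw [sin_sub] at h1l h1r
  rw [sin_add] at h2l h2r
  have e : θ = arctan (tan θ) := (arctan_tan (by linarith) hθ').symm
  rw [abs_le]
  unfold waveAngle
  constructor
  · rw [e, ← arctan_neg, ← tan_neg]
    apply arctan_mono
    rw [tan_neg, tan_eq_sin_div_cos, ← neg_div, div_le_div_iff₀ hc hp]
    linarith
  · rw [e]
    apply arctan_mono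
    rw [tan_eq_sin_div_cos, div_le_div_iff₀ hp hc]
    linarith

theorem waveAngle_eq_neg {θ z y : ℝ} (hθ : 0 < θ) (hθ' : θ < π / 2) (hz : |z| < 1)
    (h : z * sin (y + θ) = -sin θ) : waveAngle z y = -θ := by
  have hp := one_add_mul_cos_pos hz (y := y)
  have hc : 0 < cos θ := cos_pos_of_mem_Ioo ⟨by linarith, by linarith⟩
  rw [sin_add] at h
  have : z * sin y / (1 + z * cos y) = tan (-θ) := by
    rw [tan_neg, tan_eq_sin_div_cos, ← neg_div, div_eq_div_iff hp.ne' hc.ne']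
    linarith
  rw [waveAngle, this, arctan_tan (by linarith) (by linarith)]

theorem waveAngle_neg (z y : ℝ) : waveAngle z (-y) = -waveAngle z y := by
  unfold waveAngle
  rw [sin_neg, cos_neg, ← arctan_neg]
  congr 1
  ring

theorem action_wave (z p q : ℝ) :
    -(((z * sin p) ^ 2 + (-z * sin q) ^ 2) * cos (q - p) + 2 * (z * sin p) * (-z * sin q)) /
      sin (q - p) = z ^ 2 * sin (2 * p) / 2 - z ^ 2 * sin (2 * q) / 2 := by
  by_cases h : sin (q - p) = 0
  · rw [h, div_zero]
    have : z ^ 2 * sin (2 * p) / 2 - z ^ 2 * sin (2 * q) / 2 =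
        -z ^ 2 * (sin (q - p) * cos (q + p)) := by
      rw [sin_two_mul, sin_two_mul, sin_sub, cos_add]
      have := sin_sq_add_cos_sq p
      have := sin_sq_add_cos_sq q
      grind
    rw [this, h]; ring
  · rw [div_eq_iff h, sin_two_mul, sin_two_mul, sin_sub, cos_sub]
    have := sin_sq_add_cos_sq p
    have := sin_sq_add_cos_sq q
    grind

theorem exists_sum_edgeGain_eq {θ : ℝ} {m : ℕ} (hm : 1 ≤ m) (hθ : 0 < θ)
    (hπ : (4 * m + 3) * θ = π) : ∃ a : ℤ → ℝ, (∀ k, |a k| ≤ θ) ∧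
      (∀ k, a (k + (4 * m + 3)) = a k) ∧ ∑ i ∈ Finset.range (4 * m + 3), edgeGain θ a i =
      sin θ ^ 2 * ((2 * m + 2) * tan (2 * θ) - 2 * tan (θ / 2)) := by
  have h7 := seven_mul_le_pi hm hθ hπ
  set ζ := 2 * sin (θ / 2) with hζ
  have hh : 0 < sin (θ / 2) := sin_pos_of_pos_of_lt_pi (by linarith) (by linarith)
  have hhc : 0 < cos (θ / 2) := cos_pos_of_mem_Ioo ⟨by linarith, by linarith⟩
  have hζ1 : ζ < 1 := by
    have : sin (θ / 2) < sin (π / 6) :=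
      sin_lt_sin_of_lt_of_le_pi_div_two (by linarith) (by linarith) (by linarith)
    rw [sin_pi_div_six] at this
    linarith
  have hs : sin θ = ζ * cos (θ / 2) := by
    rw [show sin θ = sin (2 * (θ / 2)) by ring_nf, sin_two_mul]
  let z : ℕ → ℝ := fun l => -ζ * (-1) ^ l
  have hz : ∀ l, |z l| = ζ := fun l => by
    simp only [z, abs_mul, abs_neg, abs_pow, abs_one, one_pow, mul_one]
    exact abs_of_pos (by positivity)
  let y : ℕ → ℝ := fun l => 2 * θ * (l - m)
  let B : ℕ → ℝ := fun l => if l ≤ 2 * m then waveAngle (z l) (y l) else -θ * (-1) ^ l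
  have hpow : ∀ l, (-1 : ℝ) ^ l = 1 ∨ (-1 : ℝ) ^ l = -1 := fun l => neg_one_pow_eq_or ℝ l
  have hsin : ∀ u : ℝ, |u| ≤ π / 2 - θ / 2 → |sin u| ≤ cos (θ / 2) := by
    intro u hu
    obtain ⟨hu1, hu2⟩ := abs_le.1 hu
    rw [← sin_pi_div_two_sub, abs_le, ← sin_neg]
    exact ⟨sin_le_sin_of_le_of_le_pi_div_two (by linarith) (by linarith) hu1,
      sin_le_sin_of_le_of_le_pi_div_two (by linarith) (by linarith) hu2⟩
  have hB : ∀ l, |B l| ≤ θ := by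
    intro l
    simp only [B]
    split_ifs with hl
    · have hl' : (l : ℝ) ≤ 2 * m := by exact_mod_cast hl
      have hl0 : (0 : ℝ) ≤ l := by positivity
      have hy1 : y l ≤ 2 * θ * m := by simp only [y]; nlinarith
      have hy2 : -(2 * θ * m) ≤ y l := by simp only [y]; nlinarith
      apply abs_waveAngle_le hθ (by linarith) (by rw [hz]; exact hζ1)
      · rw [abs_mul, hz, hs]
        exact mul_le_mul_of_nonneg_left
          (hsin _ (abs_le.2 ⟨by linarith, by linarith⟩)) (by positivity)
      · rw [abs_mul, hz, hs]
        exact mul_le_mul_of_nonneg_left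
          (hsin _ (abs_le.2 ⟨by linarith, by linarith⟩)) (by positivity)
    · rcases hpow l with h | h <;> rw [h] <;> simp [abs_of_pos hθ]
  have hend : waveAngle (-ζ) (2 * θ * m) = -θ := by
    apply waveAngle_eq_neg hθ (by linarith)
    · rw [abs_neg, abs_of_pos (by positivity)]; exact hζ1
    · rw [show 2 * θ * m + θ = π / 2 - θ / 2 by linarith, sin_pi_div_two_sub, hs]; ring
  have hB0 : B 0 = θ := by
    simp only [B, z, y, Nat.zero_le, if_true, pow_zero, mul_one, Nat.cast_zero, zero_sub]
    rw [mul_neg, waveAngle_neg, hend, neg_neg]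
  have hBn : B (4 * m + 3) = θ := by
    simp only [B]
    rw [if_neg (by omega), Odd.neg_one_pow ⟨2 * m + 1, by ring⟩]
    ring
  have hBm : ∀ l, 2 * m ≤ l → B l = -θ * (-1) ^ l := by
    intro l hl
    rcases eq_or_lt_of_le hl with h | h
    · rw [← h]
      simp only [B, z, y, le_refl, if_true, pow_mul, neg_one_sq, one_pow, mul_one]
      push_cast
      rw [show 2 * θ * (2 * m - m : ℝ) = 2 * θ * m by ring, hend]
    · simp only [B]; rw [if_neg (by omega)]
  have hwin : ∀ l, l < 2 * m → gain θ (B l) (B (l + 1)) =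
      -(ζ ^ 2 * sin (2 * (y (l + 1) - B (l + 1))) / 2 - ζ ^ 2 * sin (2 * (y l - B l)) / 2) := by
    intro l hl
    have e1 : sin (B l) = z l * sin (y l - B l) := by
      simp only [B]; rw [if_pos (by omega)]; exact sin_waveAngle (by rw [hz]; exact hζ1)
    have e2 : sin (B (l + 1)) = -z l * sin (y (l + 1) - B (l + 1)) := by
      rw [show -z l = z (l + 1) by simp only [z]; ring]
      simp only [B]; rw [if_pos (by omega)]; exact sin_waveAngle (by rw [hz]; exact hζ1)
    have e3 : z l ^ 2 = ζ ^ 2 := by rw [← sq_abs, hz]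
    have := action_wave (z l) (y l - B l) (y (l + 1) - B (l + 1))
    rw [← e1, ← e2, e3] at this
    rw [neg_sub, ← this]
    unfold gain
    rw [show y (l + 1) - B (l + 1) - (y l - B l) = 2 * θ + B l - B (l + 1) by
      simp only [y]; push_cast; ring]
  have hwsum : ∑ l ∈ Finset.range (2 * m), gain θ (B l) (B (l + 1)) =
      -(2 * (sin θ ^ 2 * tan (θ / 2))) := by
    rw [Finset.sum_congr rfl fun l hl => hwin l (Finset.mem_range.1 hl), Finset.sum_neg_distrib,
      Finset.sum_range_sub (fun l => ζ ^ 2 * sin (2 * (y l - B l)) / 2), hB0, hBm _ le_rfl]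
    simp only [y, pow_mul, neg_one_sq, one_pow, mul_one]
    push_cast
    rw [show 2 * (2 * θ * (2 * m - m) - -θ) = π - θ by linarith,
      show 2 * (2 * θ * (0 - m) - θ) = -(π - θ) by linarith, sin_neg, sin_pi_sub, hs, hζ,
      tan_eq_sin_div_cos]
    field_simp
    ring
  have hosum : ∀ r : ℕ, ∑ l ∈ Finset.range (2 * r + 1), gain θ (B (2 * m + l)) (B (2 * m + l + 1)) =
      2 * r * (sin θ ^ 2 * tan (2 * θ)) := by
    have g0 : ∀ l, gain θ (B (2 * m + 2 * l)) (B (2 * m + 2 * l + 1)) = 0 := by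
      intro l
      rw [hBm _ (by omega), hBm _ (by omega), pow_succ, ← mul_add, pow_mul, neg_one_sq, one_pow]
      unfold gain
      rw [show 2 * θ + -θ * 1 - -θ * (1 * -1) = 0 by ring, sin_zero, div_zero]
    have g1 : ∀ l, gain θ (B (2 * m + (2 * l + 1))) (B (2 * m + (2 * l + 1) + 1)) =
        2 * (sin θ ^ 2 * tan (2 * θ)) := by
      intro l
      rw [hBm _ (by omega), hBm _ (by omega), pow_succ, ← add_assoc, pow_succ, ← mul_add, pow_mul]
      have hS : 0 < sin (2 * θ) := sin_pos_of_pos_of_lt_pi (by linarith) (by linarith)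
      have hC : 0 < cos (2 * θ) := cos_pos_of_mem_Ioo ⟨by linarith, by linarith⟩
      simp only [neg_one_sq, one_pow, mul_one, gain, mul_neg, neg_neg, sin_neg]
      rw [show 2 * θ + θ - -θ = 2 * (2 * θ) by ring, sin_two_mul (2 * θ), cos_two_mul' (2 * θ),
        tan_eq_sin_div_cos]
      have := sin_sq_add_cos_sq (2 * θ)
      field_simp
      grind
    intro r
    induction r with
    | zero => simpa using g0 0
    | succ r ih =>
      rw [show 2 * (r + 1) + 1 = 2 * r + 1 + 1 + 1 by ring, Finset.sum_range_succ,
        Finset.sum_range_succ, ih, g1, show 2 * r + 1 + 1 = 2 * (r + 1) by ring, g0]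
      push_cast; ring
  have hmod : ∀ k : ℤ, 0 ≤ k → k < 4 * m + 3 → k % (4 * m + 3) = k := fun k h1 h2 =>
    Int.emod_eq_of_lt h1 h2
  refine ⟨fun k => B (k % (4 * m + 3)).toNat, fun k => hB _, fun k => by simp, ?_⟩
  have hval : ∀ i : ℕ, i ≤ 4 * m + 3 → B ((i : ℤ) % (4 * m + 3)).toNat = B i := by
    intro i hi
    rcases eq_or_lt_of_le hi with h | h
    · rw [h, hBn]; push_cast; simp [hB0]
    · rw [hmod i (by omega) (by omega)]; simp
  have hval2 : ∀ i ∈ Finset.range (4 * m + 3),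
      edgeGain θ (fun k => B (k % (4 * m + 3)).toNat) i = gain θ (B i) (B (i + 1)) := by
    intro i hi
    rw [Finset.mem_range] at hi
    have h1 := hval i (by omega)
    have h2 := hval (i + 1) (by omega)
    push_cast at h2
    simp only [edgeGain, h1, h2]
  rw [Finset.sum_congr rfl hval2, show 4 * m + 3 = 2 * m + (2 * (m + 1) + 1) by ring,
    Finset.sum_range_add, hwsum, hosum]
  push_cast; ring

/-- The distance from the first endpoint of an edge of length `2 sin θ` to the apex of the triangle
above it. -/
def leftLeg (θ a b : ℝ) : ℝ := 2 * sin θ * sin (θ - b) / sin (2 * θ + a - b)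

/-- The distance from the second endpoint of an edge of length `2 sin θ` to the apex of the
triangle above it. -/
def rightLeg (θ a b : ℝ) : ℝ :=
  if 2 * θ + a - b = 0 then 2 * sin θ else 2 * sin θ * sin (θ + a) / sin (2 * θ + a - b)

section
variable {θ a b : ℝ} (hθ : 0 < θ) (hθ' : θ < π / 4) (ha : |a| ≤ θ) (hb : |b| ≤ θ)
include hθ hθ' ha hb

theorem leftLeg_nonneg : 0 ≤ leftLeg θ a b := by
  obtain ⟨ha1, ha2⟩ := abs_le.1 ha
  obtain ⟨hb1, hb2⟩ := abs_le.1 hb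
  have h1 : 0 ≤ sin θ := sin_nonneg_of_nonneg_of_le_pi (by linarith) (by linarith)
  have h2 : 0 ≤ sin (θ - b) := sin_nonneg_of_nonneg_of_le_pi (by linarith) (by linarith)
  have h3 : 0 ≤ sin (2 * θ + a - b) :=
    sin_nonneg_of_nonneg_of_le_pi (by linarith) (by linarith)
  unfold leftLeg; positivity

theorem rightLeg_nonneg : 0 ≤ rightLeg θ a b := by
  obtain ⟨ha1, ha2⟩ := abs_le.1 ha
  obtain ⟨hb1, hb2⟩ := abs_le.1 hb
  have h1 : 0 ≤ sin θ := sin_nonneg_of_nonneg_of_le_pi (by linarith) (by linarith)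
  have h2 : 0 ≤ sin (θ + a) := sin_nonneg_of_nonneg_of_le_pi (by linarith) (by linarith)
  have h3 : 0 ≤ sin (2 * θ + a - b) :=
    sin_nonneg_of_nonneg_of_le_pi (by linarith) (by linarith)
  unfold rightLeg; split_ifs <;> positivity

omit hθ in
theorem leg_area : (leftLeg θ a b * cos a + rightLeg θ a b * cos b) / 2 =
    sin θ * cos θ + capArea θ a b := by
  obtain ⟨ha1, ha2⟩ := abs_le.1 ha
  obtain ⟨hb1, hb2⟩ := abs_le.1 hb
  unfold leftLeg rightLeg capArea
  split_ifs with h0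
  · have h2 : b = θ := by linarith
    rw [h0, h2]; simp; ring
  · have hs : 0 < sin (2 * θ + a - b) :=
      sin_pos_of_pos_of_lt_pi (lt_of_le_of_ne (by linarith) (Ne.symm h0)) (by linarith)
    have e : 2 * θ + a - b = (θ + a) + (θ - b) := by ring
    have e1 : cos a = cos ((θ + a) - θ) := by ring_nf
    have e2 : cos b = cos (θ - (θ - b)) := by ring_nf
    rw [e] at hs ⊢
    rw [e1, e2]
    generalize θ + a = A at *
    generalize θ - b = B at *
    field_simp
    simp only [sin_add, cos_sub]
    ring

omit hθ in
theorem legs_closed (y : ℝ) :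
    cos y + leftLeg θ a b * -sin (y - a) =
      cos (y + 2 * θ) - rightLeg θ a b * -sin (y + 2 * θ - b) ∧
    sin y + leftLeg θ a b * cos (y - a) =
      sin (y + 2 * θ) - rightLeg θ a b * cos (y + 2 * θ - b) := by
  obtain ⟨ha1, ha2⟩ := abs_le.1 ha
  obtain ⟨hb1, hb2⟩ := abs_le.1 hb
  unfold leftLeg rightLeg
  have e3 : y - a = (y + θ) - (θ + a) := by ring
  have e4 : y + 2 * θ - b = (y + θ) + (θ - b) := by ring
  have e5 : y + 2 * θ = (y + θ) + θ := by ring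
  have e6 : cos y = cos ((y + θ) - θ) := by ring_nf
  have e7 : sin y = sin ((y + θ) - θ) := by ring_nf
  rw [e3, e4, e5, e6, e7]
  split_ifs with h0
  · have h1 : θ + a = 0 := by linarith
    have h2 : θ - b = 0 := by linarith
    rw [h0, h1, h2]
    generalize y + θ = z
    simp only [cos_add, sin_add, cos_sub, sin_sub, sin_zero, cos_zero, mul_zero, zero_div]
    constructor <;> ring
  · have hs : 0 < sin (2 * θ + a - b) :=
      sin_pos_of_pos_of_lt_pi (lt_of_le_of_ne (by linarith) (Ne.symm h0)) (by linarith)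
    have e : 2 * θ + a - b = (θ + a) + (θ - b) := by ring
    rw [e] at hs ⊢
    generalize θ + a = A at *
    generalize θ - b = B at *
    generalize y + θ = z
    have := sin_sq_add_cos_sq A
    have := sin_sq_add_cos_sq B
    constructor <;> field_simp <;> simp only [sin_add, cos_add, cos_sub, sin_sub] <;> ring

end

/-- The unit vector in direction `φ`. -/
def dirVec (φ : ℝ) : E2 := !₂[cos φ, sin φ]

@[simp] theorem dirVec_zero (φ : ℝ) : dirVec φ 0 = cos φ := rfl
@[simp] theorem dirVec_one (φ : ℝ) : dirVec φ 1 = sin φ := rfl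

/-- The signed area of the parallelogram spanned by two vectors. -/
def cross (x y : E2) : ℝ := x 0 * y 1 - x 1 * y 0

/-- The coordinate of a point in direction `ψ`. -/
def height (ψ : ℝ) (x : E2) : ℝ := x 0 * cos ψ + x 1 * sin ψ

theorem E2.ext {x y : E2} (h0 : x 0 = y 0) (h1 : x 1 = y 1) : x = y := by
  ext i; fin_cases i <;> assumption

theorem exists_polar (x : E2) : ∃ r φ : ℝ, 0 ≤ r ∧ x = r • dirVec φ := by
  refine ⟨‖(⟨x 0, x 1⟩ : ℂ)‖, Complex.arg ⟨x 0, x 1⟩, norm_nonneg _, E2.ext ?_ ?_⟩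
  · simp [Complex.norm_mul_cos_arg]
  · simp [Complex.norm_mul_sin_arg]

theorem cross_dirVec (φ χ : ℝ) : cross (dirVec φ) (dirVec χ) = sin (χ - φ) := by
  simp [cross, sin_sub]; ring

/-- The apex of the triangle above the edge of the regular polygon starting at angle `y`. -/
def apex (θ a b y : ℝ) : E2 := dirVec y + leftLeg θ a b • dirVec (y - a + π / 2)

section
variable {θ a b : ℝ} (hθ : 0 < θ) (hθ' : θ < π / 4) (ha : |a| ≤ θ) (hb : |b| ≤ θ)
include hθ hθ' ha hb

omit hθ in
theorem apex_eq (y : ℝ) : apex θ a b y =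
    dirVec (y + 2 * θ) - rightLeg θ a b • dirVec (y + 2 * θ - b + π / 2) := by
  obtain ⟨h1, h2⟩ := legs_closed hθ' ha hb y
  apply E2.ext
  · simpa [apex, cos_add_pi_div_two] using h1
  · simpa [apex, sin_add_pi_div_two] using h2

omit hθ hθ' ha hb in
theorem cross_dirVec_apex (y : ℝ) : cross (dirVec y) (apex θ a b y) = leftLeg θ a b * cos a := by
  have : cos a = cos (y - (y - a)) := by ring_nf
  rw [this, cos_sub]
  simp [apex, cross, sin_add_pi_div_two, cos_add_pi_div_two]
  ring

omit hθ in
theorem cross_apex_dirVec (y : ℝ) :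
    cross (apex θ a b y) (dirVec (y + 2 * θ)) = rightLeg θ a b * cos b := by
  rw [apex_eq hθ' ha hb]
  have : cos b = cos (y + 2 * θ - (y + 2 * θ - b)) := by ring_nf
  rw [this, cos_sub]
  simp [cross, sin_add_pi_div_two, cos_add_pi_div_two]
  ring

omit hθ hθ' ha hb in
theorem height_apex_left (y : ℝ) : height (y - a) (apex θ a b y) = cos a := by
  have : cos a = cos (y - (y - a)) := by ring_nf
  rw [this, cos_sub]
  simp [apex, height, sin_add_pi_div_two, cos_add_pi_div_two]
  ring

omit hθ in
theorem height_apex_right (y : ℝ) :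
    height (y + 2 * θ - b) (apex θ a b y) = cos b := by
  rw [apex_eq hθ' ha hb]
  have : cos b = cos (y + 2 * θ - (y + 2 * θ - b)) := by ring_nf
  rw [this, cos_sub]
  simp [height, sin_add_pi_div_two, cos_add_pi_div_two]
  ring

end

theorem height_dirVec (ψ y : ℝ) : height ψ (dirVec y) = cos (y - ψ) := by
  simp [height, cos_sub]

/-- The linear map taking the standard basis to `p` and `q`. -/
def basisMap (p q : E2) : E2 →ₗ[ℝ] E2 :=
  Matrix.toLin (EuclideanSpace.basisFun (Fin 2) ℝ).toBasis
    (EuclideanSpace.basisFun (Fin 2) ℝ).toBasis !![p 0, q 0; p 1, q 1]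

theorem basisMap_apply (p q x : E2) : basisMap p q x = x 0 • p + x 1 • q := by
  apply E2.ext <;>
  simp [basisMap, Matrix.toLin_apply, Matrix.mulVec, dotProduct, Fin.sum_univ_two] <;> ring

theorem det_basisMap (p q : E2) : LinearMap.det (basisMap p q) = cross p q := by
  rw [basisMap, LinearMap.det_toLin, Matrix.det_fin_two_of, cross]; ring

theorem measurePreserving_coords :
    MeasurePreserving (fun x : E2 => (x 0, x 1)) volume (volume : Measure (ℝ × ℝ)) :=
  (volume_preserving_finTwoArrow ℝ).comp (PiLp.volume_preserving_ofLp (Fin 2))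

theorem integral_one_sub : ∫ x in (0 : ℝ)..1, (1 - x) = 1 / 2 := by
  rw [intervalIntegral.integral_sub (by simp) (by simp)]
  simp; norm_num

theorem volume_closed_triangle :
    volume {x : E2 | 0 ≤ x 0 ∧ 0 ≤ x 1 ∧ x 0 + x 1 ≤ 1} = ENNReal.ofReal (1 / 2) := by
  have hms : MeasurableSet
      {p : ℝ × ℝ | p.1 ∈ Set.Icc (0 : ℝ) 1 ∧ p.2 ∈ Set.Icc (0 : ℝ) (1 - p.1)} :=
    measurableSet_region_between_cc (f := fun _ => (0 : ℝ)) (g := fun x => 1 - x)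
      measurable_const (by fun_prop) measurableSet_Icc
  have h := measurePreserving_coords.measure_preimage hms.nullMeasurableSet
  have e : (fun x : E2 => (x 0, x 1)) ⁻¹'
      {p : ℝ × ℝ | p.1 ∈ Set.Icc (0 : ℝ) 1 ∧ p.2 ∈ Set.Icc (0 : ℝ) (1 - p.1)} =
      {x : E2 | 0 ≤ x 0 ∧ 0 ≤ x 1 ∧ x 0 + x 1 ≤ 1} := by
    ext x
    simp only [Set.mem_preimage, Set.mem_ofPred_eq, Set.mem_Icc]
    constructor
    · rintro ⟨⟨h1, h2⟩, h3, h4⟩; exact ⟨h1, h3, by linarith⟩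
    · rintro ⟨h1, h2, h3⟩; exact ⟨⟨h1, by linarith⟩, h2, by linarith⟩
  rw [e] at h
  have slice : ∀ x : ℝ, volume (Prod.mk x ⁻¹'
      {p : ℝ × ℝ | p.1 ∈ Set.Icc (0 : ℝ) 1 ∧ p.2 ∈ Set.Icc (0 : ℝ) (1 - p.1)}) =
      (Set.Icc (0 : ℝ) 1).indicator (fun x => ENNReal.ofReal (1 - x)) x := by
    intro x
    by_cases hx : x ∈ Set.Icc (0 : ℝ) 1
    · rw [Set.indicator_of_mem hx]
      have : Prod.mk x ⁻¹'
          {p : ℝ × ℝ | p.1 ∈ Set.Icc (0 : ℝ) 1 ∧ p.2 ∈ Set.Icc (0 : ℝ) (1 - p.1)} =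
          Set.Icc 0 (1 - x) := by
        ext y
        simp only [Set.mem_preimage, Set.mem_ofPred_eq, hx, true_and]
      rw [this, Real.volume_Icc, sub_zero]
    · rw [Set.indicator_of_notMem hx]
      have : Prod.mk x ⁻¹'
          {p : ℝ × ℝ | p.1 ∈ Set.Icc (0 : ℝ) 1 ∧ p.2 ∈ Set.Icc (0 : ℝ) (1 - p.1)} = ∅ := by
        ext y
        simp only [Set.mem_preimage, Set.mem_ofPred_eq, hx, false_and, Set.mem_empty_iff_false]
      rw [this, measure_empty]
  rw [h, Measure.volume_eq_prod, Measure.prod_apply hms]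
  simp only [slice]
  rw [lintegral_indicator measurableSet_Icc, ← ofReal_integral_eq_lintegral_ofReal,
    integral_Icc_eq_integral_Ioc, ← intervalIntegral.integral_of_le zero_le_one, integral_one_sub]
  · exact (Continuous.integrableOn_Icc (by fun_prop))
  · filter_upwards [ae_restrict_mem measurableSet_Icc] with x hx
    simpa using hx.2

theorem volume_open_triangle :
    volume {x : E2 | 0 < x 0 ∧ 0 < x 1 ∧ x 0 + x 1 < 1} = ENNReal.ofReal (1 / 2) := by
  have h := measurePreserving_coords.measure_preimage (measurableSet_regionBetween
    (f := fun _ => (0 : ℝ)) (g := fun x => 1 - x) measurable_const (by fun_prop)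
      (measurableSet_Ioo (a := (0 : ℝ)) (b := 1))).nullMeasurableSet
  have e : (fun x : E2 => (x 0, x 1)) ⁻¹'
      regionBetween (fun _ => (0 : ℝ)) (fun x => 1 - x) (Set.Ioo 0 1) =
      {x : E2 | 0 < x 0 ∧ 0 < x 1 ∧ x 0 + x 1 < 1} := by
    ext x
    simp only [regionBetween, Set.mem_preimage, Set.mem_ofPred_eq, Set.mem_Ioo]
    constructor
    · rintro ⟨⟨h1, h2⟩, h3, h4⟩; exact ⟨h1, h3, by linarith⟩
    · rintro ⟨h1, h2, h3⟩; exact ⟨⟨h1, by linarith⟩, h2, by linarith⟩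
  rw [e] at h
  rw [h, Measure.volume_eq_prod, volume_regionBetween_eq_integral]
  · simp only [Pi.sub_apply, sub_zero]
    rw [← integral_Ioc_eq_integral_Ioo, ← intervalIntegral.integral_of_le zero_le_one,
      integral_one_sub]
  · simp
  · exact (Continuous.integrableOn_Icc (by fun_prop)).mono_set Set.Ioo_subset_Icc_self
  · exact measurableSet_Ioo
  · intro x hx; linarith [hx.2]

theorem volume_basisMap_image (p q : E2) (S : Set E2) :
    volume (basisMap p q '' S) = ENNReal.ofReal |cross p q| * volume S := by
  rw [Measure.addHaar_image_linearMap, det_basisMap]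

theorem cross_smul_eq (p q x : E2) :
    cross p q • x = cross x q • p + cross p x • q := by
  apply E2.ext <;> simp [cross] <;> ring

theorem eq_basisMap {p q : E2} (h : cross p q ≠ 0) (x : E2) :
    x = basisMap p q !₂[cross x q / cross p q, cross p x / cross p q] := by
  rw [basisMap_apply]
  have := cross_smul_eq p q x
  apply smul_right_injective _ h
  simp only [this, smul_add, smul_smul]
  congr 2 <;> simp <;> field_simp

theorem height_basisMap (ψ : ℝ) (p q x : E2) :
    height ψ (basisMap p q x) = x 0 * height ψ p + x 1 * height ψ q := by
  simp [basisMap_apply, height]; ring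

theorem volume_sector_le {p q : E2} {ψ c : ℝ} (h : 0 < cross p q) (hc : 0 < c)
    (hp : height ψ p = c) (hq : height ψ q = c) :
    volume {x : E2 | 0 ≤ cross p x ∧ 0 ≤ cross x q ∧ height ψ x ≤ c} ≤
      ENNReal.ofReal (cross p q / 2) := by
  calc _ ≤ volume (basisMap p q '' {x : E2 | 0 ≤ x 0 ∧ 0 ≤ x 1 ∧ x 0 + x 1 ≤ 1}) := by
        apply measure_mono
        rintro x ⟨h1, h2, h3⟩
        refine ⟨_, ⟨?_, ?_, ?_⟩, (eq_basisMap h.ne' x).symm⟩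
        · exact div_nonneg h2 h.le
        · exact div_nonneg h1 h.le
        · rw [eq_basisMap h.ne' x, height_basisMap, hp, hq, ← add_mul] at h3
          exact le_of_mul_le_mul_right (by rwa [one_mul]) hc
    _ = _ := by
        rw [volume_basisMap_image, volume_closed_triangle, ← ENNReal.ofReal_mul (abs_nonneg _),
          abs_of_pos h]
        ring_nf

/-- The open triangle with vertices `0`, `p`, `q`, for positively oriented `p`, `q`. -/
def openTriangle (p q : E2) : Set E2 :=
  {x | 0 < cross p x ∧ 0 < cross x q ∧ cross x q + cross p x < cross p q}

@[fun_prop] theorem continuous_cross_left (p : E2) : Continuous (cross p) := by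
  unfold cross; fun_prop

@[fun_prop] theorem continuous_cross_right (q : E2) : Continuous (fun x => cross x q) := by
  unfold cross; fun_prop

theorem isOpen_openTriangle (p q : E2) : IsOpen (openTriangle p q) := by
  have h1 : IsOpen {x : E2 | 0 < cross p x} := isOpen_lt (by fun_prop) (by fun_prop)
  have h2 : IsOpen {x : E2 | 0 < cross x q} := isOpen_lt (by fun_prop) (by fun_prop)
  have h3 : IsOpen {x : E2 | cross x q + cross p x < cross p q} :=
    isOpen_lt (by fun_prop) (by fun_prop)
  exact h1.inter (h2.inter h3)

theorem cross_basisMap_right (p q x : E2) : cross p (basisMap p q x) = x 1 * cross p q := by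
  simp [basisMap_apply, cross]; ring

theorem cross_basisMap_left (p q x : E2) : cross (basisMap p q x) q = x 0 * cross p q := by
  simp [basisMap_apply, cross]; ring

theorem openTriangle_eq_image {p q : E2} (h : 0 < cross p q) :
    openTriangle p q = basisMap p q '' {x : E2 | 0 < x 0 ∧ 0 < x 1 ∧ x 0 + x 1 < 1} := by
  ext x
  constructor
  · rintro ⟨h1, h2, h3⟩
    refine ⟨_, ⟨div_pos h2 h, div_pos h1 h, ?_⟩, (eq_basisMap h.ne' x).symm⟩
    simpa [← add_div, div_lt_one h] using h3
  · rintro ⟨x, ⟨h1, h2, h3⟩, rfl⟩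
    refine ⟨?_, ?_, ?_⟩
    · rw [cross_basisMap_right]; positivity
    · rw [cross_basisMap_left]; positivity
    · rw [cross_basisMap_right, cross_basisMap_left, ← add_mul]
      exact mul_lt_of_lt_one_left h h3

theorem volume_openTriangle {p q : E2} (h : 0 ≤ cross p q) :
    ENNReal.ofReal (cross p q / 2) ≤ volume (openTriangle p q) := by
  rcases h.eq_or_lt with h | h
  · simp [← h]
  · rw [openTriangle_eq_image h, volume_basisMap_image, volume_open_triangle,
      ← ENNReal.ofReal_mul (abs_nonneg _), abs_of_pos h]
    ring_nf; rfl

theorem openTriangle_subset {p q : E2} {Q : Set E2} (h : 0 ≤ cross p q) (hQ : Convex ℝ Q)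
    (h0 : 0 ∈ Q) (hp : p ∈ Q) (hq : q ∈ Q) : openTriangle p q ⊆ Q := by
  rcases h.eq_or_lt with h | h
  · rintro x ⟨h1, h2, h3⟩; linarith
  rw [openTriangle_eq_image h]
  rintro _ ⟨x, ⟨h1, h2, h3⟩, rfl⟩
  rw [basisMap_apply]
  have := hQ.sum_mem (t := Finset.univ) (w := ![1 - x 0 - x 1, x 0, x 1]) (z := ![0, p, q])
    (fun i _ => by fin_cases i <;> simp <;> linarith) (by simp [Fin.sum_univ_three]; ring)
    (fun i _ => by fin_cases i <;> simpa)
  simpa [Fin.sum_univ_three] using this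

theorem dirVec_sub_int_mul_two_pi (φ : ℝ) (k : ℤ) : dirVec (φ - k * (2 * π)) = dirVec φ := by
  simp [dirVec, cos_sub_int_mul_two_pi, sin_sub_int_mul_two_pi]

theorem height_sub_int_mul_two_pi (ψ : ℝ) (k : ℤ) : height (ψ - k * (2 * π)) = height ψ := by
  ext x
  simp [height, cos_sub_int_mul_two_pi, sin_sub_int_mul_two_pi]

theorem mul_emod_eq {θ : ℝ} {n : ℕ} (hπ : n * θ = π) (k : ℤ) :
    2 * θ * (k % n : ℤ) = 2 * θ * k - (k / n : ℤ) * (2 * π) := by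
  have : ((k % n : ℤ) : ℝ) + n * (k / n : ℤ) = k := by exact_mod_cast Int.emod_add_mul_ediv k n
  rw [← hπ]
  linear_combination 2 * θ * this

theorem dirVec_emod {θ : ℝ} {n : ℕ} (hπ : n * θ = π) (k : ℤ) :
    dirVec (2 * θ * (k % n : ℤ)) = dirVec (2 * θ * k) := by
  rw [mul_emod_eq hπ, dirVec_sub_int_mul_two_pi]

theorem exists_eq_mul_height {f : StrongDual ℝ E2} (hf : f ≠ 0) :
    ∃ r φ : ℝ, 0 < r ∧ ∀ x, f x = r * height φ x := by
  obtain ⟨r, φ, hr, h⟩ := exists_polar !₂[f !₂[1, 0], f !₂[0, 1]]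
  have h0 : f !₂[1, 0] = r * cos φ := by simpa using congrArg (fun x : E2 => x 0) h
  have h1 : f !₂[0, 1] = r * sin φ := by simpa using congrArg (fun x : E2 => x 1) h
  have hfx : ∀ x, f x = r * height φ x := by
    intro x
    have : x = x 0 • !₂[1, 0] + x 1 • !₂[0, 1] := by apply E2.ext <;> simp
    conv_lhs => rw [this]
    rw [map_add, map_smul, map_smul, h0, h1, height, smul_eq_mul, smul_eq_mul]
    ring
  refine ⟨r, φ, hr.lt_of_ne ?_, hfx⟩
  rintro rfl
  apply hf
  ext x
  simp [hfx]

theorem exists_support {Q : Set E2} (hQ : Convex ℝ Q) (hinter : (interior Q).Nonempty) {θ y : ℝ}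
    (hθ : 0 < θ) (hθ' : θ < π / 4) (hy : dirVec y ∉ interior Q) (hr : dirVec (y + 2 * θ) ∈ Q)
    (hl : dirVec (y - 2 * θ) ∈ Q) :
    ∃ a, |a| ≤ θ ∧ ∀ x ∈ Q, height (y - a) x ≤ cos a := by
  obtain ⟨f, hf, hmax⟩ := geometric_hahn_banach_of_nonempty_interior_point hQ hy hinter
  obtain ⟨r, φ, hr0, hfx⟩ := exists_eq_mul_height hf
  set a := toIocMod two_pi_pos (-π) (y - φ) with ha
  have hmem := toIocMod_mem_Ioc two_pi_pos (-π) (y - φ)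
  rw [← ha] at hmem
  have hφ : height φ = height (y - a) := by
    rw [ha, toIocMod, zsmul_eq_mul,
      show y - (y - φ - toIocDiv two_pi_pos (-π) (y - φ) * (2 * π)) =
        φ - ((-toIocDiv two_pi_pos (-π) (y - φ) : ℤ) : ℝ) * (2 * π) by push_cast; ring,
      height_sub_int_mul_two_pi]
  have hmax' : ∀ x ∈ Q, height (y - a) x ≤ cos a := by
    intro x hx
    have := hmax x hx
    rw [hfx, hfx, hφ, height_dirVec, sub_sub_cancel] at this
    exact le_of_mul_le_mul_left this hr0
  refine ⟨a, ?_, hmax'⟩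
  have h1 := hmax' _ hr
  have h2 := hmax' _ hl
  have hs : 0 < sin θ := sin_pos_of_pos_of_lt_pi hθ (by linarith)
  rw [height_dirVec, show y + 2 * θ - (y - a) = (a + θ) + θ by ring] at h1
  rw [height_dirVec, show y - 2 * θ - (y - a) = -((θ - a) + θ) by ring, cos_neg] at h2
  have h3 : cos a = cos ((a + θ) - θ) := by ring_nf
  have h4 : cos a = cos ((θ - a) - θ) := by rw [← cos_neg]; ring_nf
  rw [h3, cos_add, cos_sub] at h1
  rw [h4, cos_add, cos_sub (θ - a) θ] at h2
  have h5 : 0 ≤ sin (a + θ) := by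
    by_contra! h; nlinarith
  have h6 : 0 ≤ sin (θ - a) := by
    by_contra! h; nlinarith
  obtain ⟨h7, h8⟩ := hmem
  rw [abs_le]
  constructor
  · by_contra! h
    linarith [sin_neg_of_neg_of_neg_pi_lt (x := a + θ) (by linarith) (by linarith)]
  · by_contra! h
    linarith [sin_neg_of_neg_of_neg_pi_lt (x := θ - a) (by linarith) (by linarith)]

theorem exists_periodic_support {Q : Set E2} (hQ : Convex ℝ Q) (hinter : (interior Q).Nonempty)
    {θ : ℝ} {n : ℕ} (hθ : 0 < θ) (hθ' : θ < π / 4) (hπ : n * θ = π)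
    (hmem : ∀ k : ℤ, dirVec (2 * θ * k) ∈ Q) (hnot : ∀ k : ℤ, dirVec (2 * θ * k) ∉ interior Q) :
    ∃ a : ℤ → ℝ, (∀ k, |a k| ≤ θ) ∧ (∀ k, a (k + n) = a k) ∧
      ∀ k, ∀ x ∈ Q, height (dir θ a k) x ≤ cos (a k) := by
  have key : ∀ k : ℤ, ∃ a, |a| ≤ θ ∧ ∀ x ∈ Q, height (2 * θ * k - a) x ≤ cos a := fun k =>
    exists_support hQ hinter hθ hθ' (hnot k)
      (by simpa [mul_add] using hmem (k + 1)) (by simpa [mul_sub] using hmem (k - 1))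
  choose a ha hsupp using key
  refine ⟨fun k => a (k % n), fun k => ha _, fun k => by simp, fun k x hx => ?_⟩
  have := hsupp (k % n) x hx
  rwa [mul_emod_eq hπ, sub_right_comm, height_sub_int_mul_two_pi] at this

theorem exists_mem_cone {θ : ℝ} {n : ℕ} (hn : n ≠ 0) (hθ : 0 < θ) (hθ' : θ < π / 4)
    (hπ : n * θ = π) (x : E2) :
    ∃ k ∈ Finset.range n, 0 ≤ cross (dirVec (2 * θ * (k : ℤ))) x ∧
      0 ≤ cross x (dirVec (2 * θ * (k : ℤ) + 2 * θ)) := by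
  obtain ⟨r, φ, hr, rfl⟩ := exists_polar x
  have hn' : (0 : ℤ) < n := by positivity
  set k := ⌊φ / (2 * θ)⌋ with hk
  have h1 : 2 * θ * k ≤ φ := by
    rw [mul_comm, ← le_div_iff₀ (by positivity)]; exact Int.floor_le _
  have h2 : φ ≤ 2 * θ * k + 2 * θ := by
    rw [show 2 * θ * k + 2 * θ = (k + 1) * (2 * θ) by ring, ← div_le_iff₀ (by positivity)]
    exact (Int.lt_floor_add_one _).le
  refine ⟨(k % n).toNat, ?_, ?_⟩
  · rw [Finset.mem_range]
    have := Int.emod_lt_of_pos k hn'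
    have := Int.emod_nonneg k hn'.ne'
    lia
  · rw [Int.toNat_of_nonneg (Int.emod_nonneg k hn'.ne'), mul_emod_eq hπ, sub_add_eq_add_sub,
      dirVec_sub_int_mul_two_pi, dirVec_sub_int_mul_two_pi]
    have e1 : cross (dirVec (2 * θ * k)) (r • dirVec φ) = r * sin (φ - 2 * θ * k) := by
      rw [← cross_dirVec]; simp [cross]; ring
    have e2 : cross (r • dirVec φ) (dirVec (2 * θ * k + 2 * θ)) =
        r * sin (2 * θ * k + 2 * θ - φ) := by
      rw [← cross_dirVec]; simp [cross]; ring
    rw [e1, e2]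
    exact ⟨mul_nonneg hr (sin_nonneg_of_nonneg_of_le_pi (by linarith) (by linarith)),
      mul_nonneg hr (sin_nonneg_of_nonneg_of_le_pi (by linarith) (by linarith))⟩

theorem cross_antisymm (x y : E2) : cross x y = -cross y x := by
  simp [cross]; ring

theorem volume_cap_le {θ a b : ℝ} (hθ : 0 < θ) (hθ' : θ < π / 4) (ha : |a| ≤ θ) (hb : |b| ≤ θ)
    (y : ℝ) :
    volume {x : E2 | 0 ≤ cross (dirVec y) x ∧ 0 ≤ cross x (dirVec (y + 2 * θ)) ∧
      height (y - a) x ≤ cos a ∧ height (y + 2 * θ - b) x ≤ cos b} ≤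
      ENNReal.ofReal (sin θ * cos θ + capArea θ a b) := by
  obtain ⟨ha1, ha2⟩ := abs_le.1 ha
  obtain ⟨hb1, hb2⟩ := abs_le.1 hb
  have hca : 0 < cos a := cos_pos_of_mem_Ioo ⟨by linarith, by linarith⟩
  have hcb : 0 < cos b := cos_pos_of_mem_Ioo ⟨by linarith, by linarith⟩
  have hs : 0 < sin (2 * θ) := sin_pos_of_pos_of_lt_pi (by linarith) (by linarith)
  have hl := leftLeg_nonneg hθ hθ' ha hb
  have hr := rightLeg_nonneg hθ hθ' ha hb
  have hcl := cross_dirVec_apex (θ := θ) (a := a) (b := b) y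
  have hcr := cross_apex_dirVec hθ' ha hb y
  have hpl : height (y - a) (dirVec y) = cos a := by rw [height_dirVec]; ring_nf
  have hpr : height (y + 2 * θ - b) (dirVec (y + 2 * θ)) = cos b := by
    rw [height_dirVec]; ring_nf
  have hal := height_apex_left (θ := θ) (a := a) (b := b) y
  have har := height_apex_right hθ' ha hb y
  have hpp : cross (dirVec y) (dirVec (y + 2 * θ)) = sin (2 * θ) := by
    rw [cross_dirVec]; ring_nf
  rw [← leg_area hθ' ha hb]
  rcases hl.eq_or_lt with hl0 | hl0
  · have hq : apex θ a b y = dirVec y := by simp [apex, ← hl0]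
    have hcr' : cross (apex θ a b y) (dirVec (y + 2 * θ)) > 0 := by rw [hq, hpp]; exact hs
    have := volume_sector_le hcr' hcb har hpr
    rw [← hl0, zero_mul, zero_add, ← hcr]
    refine (measure_mono ?_).trans this
    rintro x ⟨h1, h2, h3, h4⟩
    exact ⟨by rwa [hq], h2, h4⟩
  rcases hr.eq_or_lt with hr0 | hr0
  · have hq : apex θ a b y = dirVec (y + 2 * θ) := by rw [apex_eq hθ' ha hb]; simp [← hr0]
    have hcl' : cross (dirVec y) (apex θ a b y) > 0 := by rw [hq, hpp]; exact hs
    have := volume_sector_le hcl' hca hpl hal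
    rw [← hr0, zero_mul, add_zero, ← hcl]
    refine (measure_mono ?_).trans this
    rintro x ⟨h1, h2, h3, h4⟩
    exact ⟨h1, by rwa [hq], h3⟩
  have hcl' : cross (dirVec y) (apex θ a b y) > 0 := by rw [hcl]; positivity
  have hcr' : cross (apex θ a b y) (dirVec (y + 2 * θ)) > 0 := by rw [hcr]; positivity
  rw [← hcl, ← hcr, add_div, ENNReal.ofReal_add (by positivity) (by positivity)]
  refine le_trans (measure_mono ?_) ((measure_union_le _ _).trans (add_le_add
    (volume_sector_le hcl' hca hpl hal) (volume_sector_le hcr' hcb har hpr)))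
  rintro x ⟨h1, h2, h3, h4⟩
  rcases le_total 0 (cross x (apex θ a b y)) with h | h
  · exact Or.inl ⟨h1, h, h3⟩
  · exact Or.inr ⟨by rw [cross_antisymm]; linarith, h2, h4⟩

theorem area_cap_nonneg {θ a b : ℝ} (hθ : 0 < θ) (hθ' : θ < π / 4) (ha : |a| ≤ θ) (hb : |b| ≤ θ) :
    0 ≤ sin θ * cos θ + capArea θ a b := by
  obtain ⟨ha1, ha2⟩ := abs_le.1 ha
  obtain ⟨hb1, hb2⟩ := abs_le.1 hb
  have hca : 0 < cos a := cos_pos_of_mem_Ioo ⟨by linarith, by linarith⟩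
  have hcb : 0 < cos b := cos_pos_of_mem_Ioo ⟨by linarith, by linarith⟩
  have hl := leftLeg_nonneg hθ hθ' ha hb
  have hr := rightLeg_nonneg hθ hθ' ha hb
  rw [← leg_area hθ' ha hb]
  positivity

theorem sum_area_cap {θ : ℝ} {n : ℕ} (hθ : 0 < θ) (hθ' : θ < π / 4) {a : ℤ → ℝ}
    (ha : ∀ k, |a k| ≤ θ) (hper : ∀ k, a (k + n) = a k) :
    ∑ i ∈ Finset.range n, (sin θ * cos θ + capArea θ (a i) (a (i + 1))) =
      n * tan θ + tan θ ^ 2 / 2 * ∑ i ∈ Finset.range n, edgeGain θ a i := by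
  have htel := Finset.sum_range_sub (fun i : ℕ => sin (a i) * cos (a i)) n
  have h0 : a n = a 0 := by simpa using hper 0
  simp only [Nat.cast_add, Nat.cast_one, Nat.cast_zero, h0, sub_self] at htel
  have hc : 0 < cos θ := cos_pos_of_mem_Ioo ⟨by linarith, by linarith⟩
  have htan : sin θ * cos θ + tan θ * sin θ ^ 2 = tan θ := by
    rw [tan_eq_sin_div_cos]
    field_simp
    linear_combination sin θ * sin_sq_add_cos_sq θ
  calc _ = ∑ i ∈ Finset.range n, (tan θ - tan θ ^ 2 / 2 *
        (sin (a (i + 1)) * cos (a (i + 1)) - sin (a i) * cos (a i)) +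
          tan θ ^ 2 / 2 * edgeGain θ a i) := by
        refine Finset.sum_congr rfl fun i _ => ?_
        rw [capArea_eq hθ hθ' (ha _) (ha _), edgeGain]
        linear_combination htan
    _ = _ := by
        rw [Finset.sum_add_distrib, Finset.sum_sub_distrib, ← Finset.mul_sum, htel,
          ← Finset.mul_sum]
        simp

theorem volume_le_of_support {Q : Set E2} {θ : ℝ} {n : ℕ} (hn : n ≠ 0) (hθ : 0 < θ)
    (hθ' : θ < π / 4) (hπ : n * θ = π) {a : ℤ → ℝ} (ha : ∀ k, |a k| ≤ θ)
    (hper : ∀ k, a (k + n) = a k) (hsupp : ∀ k, ∀ x ∈ Q, height (dir θ a k) x ≤ cos (a k)) :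
    volume Q ≤ ENNReal.ofReal
      (n * tan θ + tan θ ^ 2 / 2 * ∑ i ∈ Finset.range n, edgeGain θ a i) := by
  rw [← sum_area_cap hθ hθ' ha hper, ENNReal.ofReal_sum_of_nonneg fun i _ =>
    area_cap_nonneg hθ hθ' (ha _) (ha _)]
  refine le_trans (measure_mono ?_) ((measure_biUnion_finset_le _ _).trans
    (Finset.sum_le_sum fun i _ => volume_cap_le hθ hθ' (ha i) (ha (i + 1)) (2 * θ * (i : ℤ))))
  intro x hx
  obtain ⟨k, hk, h1, h2⟩ := exists_mem_cone hn hθ hθ' hπ x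
  simp only [Set.mem_iUnion]
  refine ⟨k, hk, h1, h2, hsupp k x hx, ?_⟩
  convert hsupp (k + 1) x hx using 2
  simp [dir]; ring

theorem dirVec_add_int_mul_two_pi (φ : ℝ) (k : ℤ) : dirVec (φ + k * (2 * π)) = dirVec φ := by
  simp [dirVec, cos_add_int_mul_two_pi, sin_add_int_mul_two_pi]

theorem height_smul_add (ψ t : ℝ) (x y : E2) :
    height ψ (x + t • y) = height ψ x + t * height ψ y := by
  simp [height]; ring

/-- The vertices of the polygon whose edge through the `k`-th vertex of the regular polygon has
outer normal direction `dir θ a k`. -/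
def outerVtx (θ : ℝ) (a : ℤ → ℝ) (k : ℤ) : E2 := apex θ (a k) (a (k + 1)) (2 * θ * k)

/-- The polygon whose edge through the `k`-th vertex of the regular polygon has outer normal
direction `dir θ a k`. -/
def outerPoly (θ : ℝ) (a : ℤ → ℝ) (n : ℕ) : Set E2 :=
  convexHull ℝ ((Finset.range n).image fun k : ℕ => outerVtx θ a k : Finset E2)

theorem convex_outerPoly (θ : ℝ) (a : ℤ → ℝ) (n : ℕ) : Convex ℝ (outerPoly θ a n) :=
  convex_convexHull ℝ _

section
variable {θ : ℝ} {a : ℤ → ℝ} {n : ℕ} (hθ : 0 < θ) (hθ' : θ < π / 4) (ha : ∀ k, |a k| ≤ θ)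
  (hπ : n * θ = π) (hper : ∀ k, a (k + n) = a k)

theorem outerVtx_eq_add (k : ℤ) : outerVtx θ a k =
    dirVec (2 * θ * k) + leftLeg θ (a k) (a (k + 1)) • dirVec (dir θ a k + π / 2) := rfl

include hθ' ha in
theorem outerVtx_eq_sub (k : ℤ) : outerVtx θ a k = dirVec (2 * θ * (k + 1 : ℤ)) -
    rightLeg θ (a k) (a (k + 1)) • dirVec (dir θ a (k + 1) + π / 2) := by
  rw [outerVtx, apex_eq hθ' (ha _) (ha _), dir,
    show 2 * θ * (k + 1 : ℤ) = 2 * θ * k + 2 * θ by push_cast; ring]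

include hπ hper in
theorem outerVtx_periodic (k : ℤ) : outerVtx θ a (k + n) = outerVtx θ a k := by
  have h1 : 2 * θ * (k + n : ℤ) = 2 * θ * k + (1 : ℤ) * (2 * π) := by
    push_cast; rw [← hπ]; ring
  rw [outerVtx_eq_add, outerVtx_eq_add, dir, dir, h1, dirVec_add_int_mul_two_pi, hper,
    show k + n + 1 = k + 1 + n by ring, hper, add_sub_right_comm, add_right_comm,
    dirVec_add_int_mul_two_pi]

include hπ hper in
theorem dir_add_period (k : ℤ) : dir θ a (k + n) = dir θ a k + 2 * π := by
  rw [dir, dir, hper, ← hπ]; push_cast; ring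

include hθ hθ' ha in
theorem exists_height_outerVtx_succ (k : ℤ) : ∃ c, 0 ≤ c ∧ ∀ ψ,
    height ψ (outerVtx θ a (k + 1)) =
      height ψ (outerVtx θ a k) - c * sin (dir θ a (k + 1) - ψ) := by
  refine ⟨rightLeg θ (a k) (a (k + 1)) + leftLeg θ (a (k + 1)) (a (k + 1 + 1)),
    add_nonneg (rightLeg_nonneg hθ hθ' (ha _) (ha _)) (leftLeg_nonneg hθ hθ' (ha _) (ha _)),
    fun ψ => ?_⟩
  rw [outerVtx_eq_add, outerVtx_eq_sub hθ' ha, sub_eq_add_neg (dirVec _) (_ • _), ← neg_smul,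
    height_smul_add,
    height_smul_add, height_dirVec ψ (_ + _), add_sub_right_comm, cos_add_pi_div_two]
  ring

include hθ hθ' ha in
theorem height_outerVtx_add_le (k : ℤ) (i : ℕ) (h : dir θ a (k + i) - dir θ a k ≤ π) :
    height (dir θ a k) (outerVtx θ a (k + i)) ≤ cos (a k) := by
  induction i with
  | zero =>
    simp only [Nat.cast_zero, add_zero]
    exact (height_apex_left _).le
  | succ i ih =>
    have hm := dir_mono ha
    push_cast at h ⊢
    rw [← add_assoc] at h ⊢
    have h1 := hm (show k + i ≤ k + i + 1 by lia)
    have h2 := hm (show k ≤ k + i + 1 by lia)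
    obtain ⟨c, hc, hstep⟩ := exists_height_outerVtx_succ hθ hθ' ha (k + i)
    rw [hstep]
    have := mul_nonneg hc (sin_nonneg_of_nonneg_of_le_pi
      (x := dir θ a (k + i + 1) - dir θ a k) (by linarith) h)
    linarith [ih (by linarith)]

include hθ hθ' ha in
theorem height_outerVtx_sub_le (k : ℤ) (i : ℕ) (h : dir θ a k - dir θ a (k - i) ≤ π) :
    height (dir θ a k) (outerVtx θ a (k - i - 1)) ≤ cos (a k) := by
  induction i with
  | zero =>
    have := height_apex_right hθ' (ha (k - 1)) (ha k) (2 * θ * (k - 1 : ℤ))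
    simp only [Nat.cast_zero, sub_zero, outerVtx, sub_add_cancel]
    rw [← this]
    apply le_of_eq
    congr 1
    simp [dir]; ring
  | succ i ih =>
    have hm := dir_mono ha
    push_cast at h ⊢
    rw [← sub_sub] at h ⊢
    have h1 := hm (show k - i - 1 ≤ k - i by lia)
    have h2 := hm (show k - i - 1 ≤ k by lia)
    obtain ⟨c, hc, hstep⟩ := exists_height_outerVtx_succ hθ hθ' ha (k - i - 1 - 1)
    have hstep := hstep (dir θ a k)
    rw [sub_add_cancel] at hstep
    have := mul_nonneg hc (sin_nonneg_of_nonneg_of_le_pi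
      (x := dir θ a k - dir θ a (k - i - 1)) (by linarith) h)
    rw [← neg_sub, sin_neg] at this
    linarith [ih (by linarith)]

include hπ hper in
theorem outerVtx_add_mul (k c : ℤ) : outerVtx θ a (k + c * n) = outerVtx θ a k := by
  have : Function.Periodic (outerVtx θ a) (n : ℤ) := outerVtx_periodic hπ hper
  simpa using this.int_mul c k

include hθ hθ' ha hπ hper in
theorem height_outerVtx_le (hn : n ≠ 0) (k j : ℤ) :
    height (dir θ a k) (outerVtx θ a j) ≤ cos (a k) := by
  have hn' : (0 : ℤ) < n := by positivity
  have h0 := Int.emod_nonneg (j - k) hn'.ne'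
  have hlt := Int.emod_lt_of_pos (j - k) hn'
  have he := Int.emod_add_ediv_mul (j - k) n
  lift (j - k) % n to ℕ using h0 with i
  have hj : j = k + i + (j - k) / n * n := by lia
  rw [hj, outerVtx_add_mul hπ hper]
  by_cases h : dir θ a (k + i) - dir θ a k ≤ π
  · exact height_outerVtx_add_le hθ hθ' ha k i h
  · have hi : ((n - 1 - i : ℕ) : ℤ) = n - 1 - i := by lia
    have := height_outerVtx_sub_le hθ hθ' ha k (n - 1 - i)
    rw [hi, show k - (n - 1 - i) - 1 = k + i + (-1) * (n : ℤ) by ring,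
      outerVtx_add_mul hπ hper] at this
    apply this
    have h1 := dir_add_period hπ hper (k - (n - 1 - i))
    rw [show k - ((n : ℤ) - 1 - i) + n = k + i + 1 by ring] at h1
    have h2 := dir_mono ha (show k + i ≤ k + i + 1 by lia)
    linarith

include hπ hper in
theorem outerVtx_mem_outerPoly (hn : n ≠ 0) (k : ℤ) : outerVtx θ a k ∈ outerPoly θ a n := by
  have hn' : (0 : ℤ) < n := by positivity
  have h0 := Int.emod_nonneg k hn'.ne'
  have hlt := Int.emod_lt_of_pos k hn'
  have he := Int.emod_add_ediv_mul k n
  rw [← he, outerVtx_add_mul hπ hper]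
  lift k % n to ℕ using h0 with i
  apply subset_convexHull
  simp only [Finset.coe_image, Set.mem_image]
  exact ⟨i, by simpa using hlt, rfl⟩

theorem convex_height_le (ψ c : ℝ) : Convex ℝ {x : E2 | height ψ x ≤ c} := by
  refine convex_halfSpace_le ⟨fun x y => ?_, fun t x => ?_⟩ c <;> simp [height] <;> ring

include hθ hθ' ha hπ hper in
theorem height_le_of_mem_outerPoly (hn : n ≠ 0) (k : ℤ) {x : E2} (hx : x ∈ outerPoly θ a n) :
    height (dir θ a k) x ≤ cos (a k) := by
  refine convexHull_min ?_ (convex_height_le (dir θ a k) (cos (a k))) hx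
  intro y hy
  simp only [Finset.coe_image, Set.mem_image] at hy
  obtain ⟨j, -, rfl⟩ := hy
  exact height_outerVtx_le hθ hθ' ha hπ hper hn k j

include hθ hθ' ha hπ hper in
theorem dirVec_mem_outerPoly (hn : n ≠ 0) (k : ℤ) : dirVec (2 * θ * k) ∈ outerPoly θ a n := by
  have hr := rightLeg_nonneg hθ hθ' (ha (k - 1)) (ha (k - 1 + 1))
  have hl := leftLeg_nonneg hθ hθ' (ha k) (ha (k + 1))
  have h1 := outerVtx_eq_sub hθ' ha (k - 1)
  have h2 := outerVtx_eq_add (θ := θ) (a := a) k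
  have m1 := outerVtx_mem_outerPoly hπ hper hn (k - 1)
  have m2 := outerVtx_mem_outerPoly hπ hper hn k
  rw [sub_add_cancel] at h1 hr
  generalize rightLeg θ (a (k - 1)) (a k) = r at *
  generalize leftLeg θ (a k) (a (k + 1)) = l at *
  rcases (add_nonneg hl hr).eq_or_lt with h | h
  · have : r = 0 := by linarith
    simp only [this, zero_smul, sub_zero] at h1
    rwa [← h1]
  · have hmem := convex_outerPoly θ a n m1 m2 (div_nonneg hl h.le) (div_nonneg hr h.le)
      (by rw [← add_div, div_self h.ne'])
    rw [h1, h2] at hmem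
    convert hmem using 1
    apply E2.ext <;> simp <;> field_simp <;> ring

include hθ hθ' ha hπ hper in
theorem dirVec_mem_frontier_outerPoly (hn : n ≠ 0) (k : ℤ) :
    dirVec (2 * θ * k) ∈ frontier (outerPoly θ a n) := by
  refine ⟨subset_closure (dirVec_mem_outerPoly hθ hθ' ha hπ hper hn k), fun hinter => ?_⟩
  have hcont : Continuous fun t : ℝ => dirVec (2 * θ * k) + t • dirVec (dir θ a k) := by fun_prop
  have hnhds : ∀ᶠ t in nhds (0 : ℝ),
      dirVec (2 * θ * k) + t • dirVec (dir θ a k) ∈ interior (outerPoly θ a n) :=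
    hcont.continuousAt.eventually_mem (by simpa using isOpen_interior.mem_nhds hinter)
  have hpos := (hnhds.filter_mono (nhdsWithin_le_nhds (s := Set.Ioi 0))).and
    self_mem_nhdsWithin
  obtain ⟨t, ht, ht0⟩ := hpos.exists
  have := height_le_of_mem_outerPoly hθ hθ' ha hπ hper hn k (interior_subset ht)
  rw [height_smul_add, height_dirVec, height_dirVec, sub_self, cos_zero, dir,
    sub_sub_cancel] at this
  have : 0 < t := ht0
  linarith

theorem zero_mem_of_cos_nonpos {Q : Set E2} (hQ : Convex ℝ Q) {φ : ℝ} (hφ : cos φ ≤ 0)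
    (h0 : dirVec 0 ∈ Q) (h1 : dirVec φ ∈ Q) (h2 : dirVec (-φ) ∈ Q) : 0 ∈ Q := by
  have hd : 0 < 2 - 2 * cos φ := by linarith
  have := hQ.sum_mem (t := Finset.univ)
    (w := ![-2 * cos φ / (2 - 2 * cos φ), 1 / (2 - 2 * cos φ), 1 / (2 - 2 * cos φ)])
    (z := ![dirVec 0, dirVec φ, dirVec (-φ)])
    (fun i _ => by
      fin_cases i
      · exact div_nonneg (by linarith) hd.le
      · exact (one_div_pos.2 hd).le
      · exact (one_div_pos.2 hd).le)
    (by simp only [Fin.sum_univ_three, Matrix.cons_val]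
        rw [← add_div, ← add_div, div_eq_one_iff_eq hd.ne']; ring)
    (fun i _ => by fin_cases i <;> simpa)
  convert this using 1
  apply E2.ext
  · simp [Fin.sum_univ_three]
    field_simp
    ring
  · simp [Fin.sum_univ_three]

theorem exists_floor_eq_of_mem_cone {φ : ℝ} {k : ℤ} (hθ : 0 < θ)
    (hπ : n * θ = π) (h1 : 0 < sin (φ - 2 * θ * k)) (h2 : 0 < sin (2 * θ * k + 2 * θ - φ)) :
    ∃ c : ℤ, ⌊φ / (2 * θ)⌋ = k + c * n := by
  have hmem := toIocMod_mem_Ioc two_pi_pos (-π) (φ - 2 * θ * k)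
  set c := toIocDiv two_pi_pos (-π) (φ - 2 * θ * k)
  have hu : toIocMod two_pi_pos (-π) (φ - 2 * θ * k) = φ - 2 * θ * k - c * (2 * π) := by
    rw [toIocMod, zsmul_eq_mul]
  rw [hu] at hmem
  obtain ⟨h3, h4⟩ := hmem
  rw [← sin_sub_int_mul_two_pi _ c] at h1
  rw [← sin_add_int_mul_two_pi _ c] at h2
  have h5 : 0 < φ - 2 * θ * k - c * (2 * π) := by
    by_contra! h
    linarith [sin_nonpos_of_nonpos_of_neg_pi_le h h3.le]
  have h6 : 0 < 2 * θ * k + 2 * θ - φ + c * (2 * π) := by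
    by_contra! h
    linarith [sin_nonpos_of_nonpos_of_neg_pi_le h (by linarith)]
  refine ⟨c, ?_⟩
  rw [← hπ] at h5 h6
  rw [Int.floor_eq_iff, le_div_iff₀ (by positivity), div_lt_iff₀ (by positivity)]
  push_cast
  constructor <;> linarith

theorem disjoint_cones (hθ : 0 < θ) (hπ : n * θ = π) {i j : ℕ} (hi : i < n)
    (hj : j < n) {x : E2} (h1 : 0 < cross (dirVec (2 * θ * (i : ℤ))) x)
    (h2 : 0 < cross x (dirVec (2 * θ * (i : ℤ) + 2 * θ)))
    (h3 : 0 < cross (dirVec (2 * θ * (j : ℤ))) x)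
    (h4 : 0 < cross x (dirVec (2 * θ * (j : ℤ) + 2 * θ))) : i = j := by
  obtain ⟨r, φ, hr, rfl⟩ := exists_polar x
  have e1 : ∀ ψ, cross (dirVec ψ) (r • dirVec φ) = r * sin (φ - ψ) := by
    intro ψ; rw [← cross_dirVec]; simp [cross]; ring
  have e2 : ∀ ψ, cross (r • dirVec φ) (dirVec ψ) = r * sin (ψ - φ) := by
    intro ψ; rw [← cross_dirVec]; simp [cross]; ring
  rw [e1] at h1 h3
  rw [e2] at h2 h4
  obtain ⟨c, hc⟩ := exists_floor_eq_of_mem_cone hθ hπ (pos_of_mul_pos_right h1 hr)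
    (pos_of_mul_pos_right h2 hr)
  obtain ⟨d, hd⟩ := exists_floor_eq_of_mem_cone hθ hπ (pos_of_mul_pos_right h3 hr)
    (pos_of_mul_pos_right h4 hr)
  have h5 : (i + c * n : ℤ) % n = (j + d * n : ℤ) % n := by rw [← hc, ← hd]
  rw [Int.add_mul_emod_self_right, Int.add_mul_emod_self_right,
    Int.emod_eq_of_lt (by lia) (by lia), Int.emod_eq_of_lt (by lia) (by lia)] at h5
  lia

end

theorem mem_cone_of_mem_openTriangle_left {p q p' x : E2} (hx : x ∈ openTriangle p q)
    (h : 0 < cross p p') (h' : 0 ≤ cross q p') : 0 < cross p x ∧ 0 < cross x p' := by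
  obtain ⟨h1, h2, h3⟩ := hx
  refine ⟨h1, ?_⟩
  have e : cross p q * cross x p' = cross x q * cross p p' + cross p x * cross q p' := by
    simp [cross]; ring
  have : 0 < cross p q * cross x p' := by rw [e]; positivity
  exact pos_of_mul_pos_right this (by linarith)

theorem mem_cone_of_mem_openTriangle_right {p q p' x : E2} (hx : x ∈ openTriangle q p')
    (h : 0 < cross p p') (h' : 0 ≤ cross p q) : 0 < cross p x ∧ 0 < cross x p' := by
  obtain ⟨h1, h2, h3⟩ := hx
  refine ⟨?_, h2⟩
  have e : cross q p' * cross p x = cross x p' * cross p q + cross q x * cross p p' := by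
    simp [cross]; ring
  have : 0 < cross q p' * cross p x := by rw [e]; positivity
  exact pos_of_mul_pos_right this (by linarith)

theorem disjoint_openTriangle (p q p' : E2) :
    Disjoint (openTriangle p q) (openTriangle q p') := by
  rw [Set.disjoint_left]
  rintro x ⟨-, h1, -⟩ ⟨h2, -, -⟩
  rw [cross_antisymm] at h1
  linarith

/-- The open cap of a circumscribed polygon above an edge of the regular polygon, joined to the
origin. -/
def openCap (θ a b y : ℝ) : Set E2 :=
  openTriangle (dirVec y) (apex θ a b y) ∪ openTriangle (apex θ a b y) (dirVec (y + 2 * θ))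

section
variable {θ a b : ℝ} (hθ : 0 < θ) (hθ' : θ < π / 4) (ha : |a| ≤ θ) (hb : |b| ≤ θ)
include hθ hθ' ha hb

theorem cross_dirVec_apex_nonneg (y : ℝ) : 0 ≤ cross (dirVec y) (apex θ a b y) := by
  rw [cross_dirVec_apex]
  obtain ⟨ha1, ha2⟩ := abs_le.1 ha
  exact mul_nonneg (leftLeg_nonneg hθ hθ' ha hb)
    (cos_nonneg_of_neg_pi_div_two_le_of_le (by linarith) (by linarith))

theorem cross_apex_dirVec_nonneg (y : ℝ) : 0 ≤ cross (apex θ a b y) (dirVec (y + 2 * θ)) := by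
  rw [cross_apex_dirVec hθ' ha hb]
  obtain ⟨hb1, hb2⟩ := abs_le.1 hb
  exact mul_nonneg (rightLeg_nonneg hθ hθ' ha hb)
    (cos_nonneg_of_neg_pi_div_two_le_of_le (by linarith) (by linarith))

theorem mem_cone_of_mem_openCap {x : E2} {y : ℝ} (hx : x ∈ openCap θ a b y) :
    0 < cross (dirVec y) x ∧ 0 < cross x (dirVec (y + 2 * θ)) := by
  have hpp : 0 < cross (dirVec y) (dirVec (y + 2 * θ)) := by
    rw [cross_dirVec, add_sub_cancel_left]
    exact sin_pos_of_pos_of_lt_pi (by linarith) (by linarith)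
  rcases hx with hx | hx
  · exact mem_cone_of_mem_openTriangle_left hx hpp (cross_apex_dirVec_nonneg hθ hθ' ha hb y)
  · exact mem_cone_of_mem_openTriangle_right hx hpp (cross_dirVec_apex_nonneg hθ hθ' ha hb y)

theorem le_volume_openCap (y : ℝ) :
    ENNReal.ofReal (sin θ * cos θ + capArea θ a b) ≤ volume (openCap θ a b y) := by
  have h1 := cross_dirVec_apex_nonneg hθ hθ' ha hb y
  have h2 := cross_apex_dirVec_nonneg hθ hθ' ha hb y
  rw [← leg_area hθ' ha hb, ← cross_dirVec_apex y, ← cross_apex_dirVec hθ' ha hb y, add_div,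
    ENNReal.ofReal_add (by positivity) (by positivity), openCap,
    measure_union (disjoint_openTriangle _ _ _) (isOpen_openTriangle _ _).measurableSet]
  exact add_le_add (volume_openTriangle h1) (volume_openTriangle h2)

end

theorem volume_outerPoly {θ : ℝ} {a : ℤ → ℝ} {n : ℕ} (hn : n ≠ 0) (hθ : 0 < θ)
    (hθ' : θ < π / 4) (ha : ∀ k, |a k| ≤ θ) (hπ : n * θ = π) (hper : ∀ k, a (k + n) = a k)
    (h0 : 0 ∈ outerPoly θ a n) : volume (outerPoly θ a n) = ENNReal.ofReal
      (n * tan θ + tan θ ^ 2 / 2 * ∑ i ∈ Finset.range n, edgeGain θ a i) := by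
  apply le_antisymm
  · exact volume_le_of_support hn hθ hθ' hπ ha hper
      fun k x hx => height_le_of_mem_outerPoly hθ hθ' ha hπ hper hn k hx
  rw [← sum_area_cap hθ hθ' ha hper, ENNReal.ofReal_sum_of_nonneg fun i _ =>
    area_cap_nonneg hθ hθ' (ha _) (ha _)]
  calc _ ≤ ∑ i ∈ Finset.range n, volume (openCap θ (a i) (a (i + 1)) (2 * θ * (i : ℤ))) :=
        Finset.sum_le_sum fun i _ => le_volume_openCap hθ hθ' (ha _) (ha _) _
    _ = volume (⋃ i ∈ Finset.range n, openCap θ (a i) (a (i + 1)) (2 * θ * (i : ℤ))) := by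
        rw [measure_biUnion_finset]
        · intro i hi j hj hij
          refine Set.disjoint_left.2 fun x hxi hxj => hij ?_
          obtain ⟨h1, h2⟩ := mem_cone_of_mem_openCap hθ hθ' (ha _) (ha _) hxi
          obtain ⟨h3, h4⟩ := mem_cone_of_mem_openCap hθ hθ' (ha _) (ha _) hxj
          exact disjoint_cones hθ hπ (Finset.mem_range.1 hi) (Finset.mem_range.1 hj)
            h1 h2 h3 h4
        · intro i _
          exact ((isOpen_openTriangle _ _).union (isOpen_openTriangle _ _)).measurableSet
    _ ≤ _ := by
        apply measure_mono
        simp only [Set.iUnion_subset_iff]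
        intro i _
        have m1 := dirVec_mem_outerPoly hθ hθ' ha hπ hper hn i
        have m2 := dirVec_mem_outerPoly hθ hθ' ha hπ hper hn (i + 1)
        have m3 := outerVtx_mem_outerPoly hπ hper hn (a := a) i
        rw [show 2 * θ * ((i + 1 : ℤ) : ℝ) = 2 * θ * (i : ℤ) + 2 * θ by push_cast; ring] at m2
        exact Set.union_subset
          (openTriangle_subset (cross_dirVec_apex_nonneg hθ hθ' (ha _) (ha _) _)
            (convex_outerPoly θ a n) h0 m1 m3)
          (openTriangle_subset (cross_apex_dirVec_nonneg hθ hθ' (ha _) (ha _) _)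
            (convex_outerPoly θ a n) h0 m3 m2)

theorem regVtx_eq_dirVec {n : ℕ} {θ : ℝ} (hn : n ≠ 0) (hπ : n * θ = π) (k : ℕ) :
    regVtx n k = dirVec (2 * θ * (k : ℤ)) := by
  have hn' : (n : ℝ) ≠ 0 := by positivity
  have : 2 * π * k / n = 2 * θ * (k : ℤ) := by
    rw [← hπ]; push_cast; field_simp
  rw [regVtx, this]; rfl

theorem forall_dirVec_of_forall_regVtx {n : ℕ} {θ : ℝ} (hn : n ≠ 0) (hπ : n * θ = π) {p : E2 → Prop}
    (h : ∀ k : Fin n, p (regVtx n k)) (k : ℤ) : p (dirVec (2 * θ * k)) := by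
  have hn' : (0 : ℤ) < n := by positivity
  have h0 := Int.emod_nonneg k hn'.ne'
  have hlt := Int.emod_lt_of_pos k hn'
  rw [← dirVec_emod hπ]
  lift k % n to ℕ using h0 with i
  have := h ⟨i, by lia⟩
  rwa [regVtx_eq_dirVec hn hπ] at this

theorem isConvexPolygon_outerPoly (θ : ℝ) (a : ℤ → ℝ) (n : ℕ) :
    IsConvexPolygon (outerPoly θ a n) := ⟨_, rfl⟩

theorem volume_eq_zero_of_interior_eq_empty {Q : Set E2} (hQ : Convex ℝ Q)
    (hinter : interior Q = ∅) : volume Q = 0 := by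
  refine measure_mono_null ?_ (hQ.addHaar_frontier volume)
  rw [frontier, hinter, Set.sdiff_empty]
  exact subset_closure

theorem maxCircArea_eq {m : ℕ} (hm : 1 ≤ m) {θ : ℝ} (hθ : 0 < θ) (hπ : (4 * m + 3) * θ = π) :
    maxCircArea (4 * m + 3) = (4 * m + 3) * tan θ + tan θ ^ 2 / 2 *
      (sin θ ^ 2 * ((2 * m + 2) * tan (2 * θ) - 2 * tan (θ / 2))) := by
  have h7 := seven_mul_le_pi hm hθ hπ
  have hθ' : θ < π / 4 := by linarith
  have hn : 4 * m + 3 ≠ 0 := by lia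
  have hπ' : ((4 * m + 3 : ℕ) : ℝ) * θ = π := by push_cast; exact hπ
  obtain ⟨a, ha, hper, hsum⟩ := exists_sum_edgeGain_eq hm hθ hπ
  have hper' : ∀ k, a (k + (4 * m + 3 : ℕ)) = a k := by intro k; push_cast; exact hper k
  have hp := dirVec_mem_outerPoly hθ hθ' ha hπ' hper' hn
  have hzero : 0 ∈ outerPoly θ a (4 * m + 3) := by
    have e : 2 * θ * ((m + 1 : ℕ) : ℤ) = π / 2 + θ / 2 := by
      rw [← hπ]; push_cast; ring
    refine zero_mem_of_cos_nonpos (convex_outerPoly _ _ _) (φ := 2 * θ * ((m + 1 : ℕ) : ℤ)) ?_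
      (by simpa using hp 0) (hp _) ?_
    · rw [e]
      exact cos_nonpos_of_pi_div_two_le_of_le (by linarith) (by linarith)
    · have := hp (-((m + 1 : ℕ) : ℤ))
      rwa [Int.cast_neg, mul_neg] at this
  have hvol := volume_outerPoly hn hθ hθ' ha hπ' hper' hzero
  rw [hsum] at hvol
  push_cast at hvol
  set V := (4 * m + 3) * tan θ + tan θ ^ 2 / 2 *
      (sin θ ^ 2 * ((2 * m + 2) * tan (2 * θ) - 2 * tan (θ / 2))) with hV
  have hV0 : 0 ≤ V := by
    rw [hV, ← hsum]
    have := sum_area_cap hθ hθ' ha hper'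
    push_cast at this
    rw [← this]
    exact Finset.sum_nonneg fun i _ => area_cap_nonneg hθ hθ' (ha _) (ha _)
  refine IsGreatest.csSup_eq ⟨⟨outerPoly θ a (4 * m + 3), isConvexPolygon_outerPoly _ _ _, ?_, ?_,
    ?_⟩, ?_⟩
  · refine convexHull_min ?_ (convex_outerPoly _ _ _)
    rintro _ ⟨k, rfl⟩
    simp only [regVtx_eq_dirVec hn hπ']
    exact hp _
  · intro k
    rw [regVtx_eq_dirVec hn hπ']
    exact dirVec_mem_frontier_outerPoly hθ hθ' ha hπ' hper' hn _
  · rw [hvol, ENNReal.toReal_ofReal hV0]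
  · rintro _ ⟨Q, ⟨F, hF⟩, hsub, hfr, rfl⟩
    have hQ : Convex ℝ Q := hF ▸ convex_convexHull ℝ _
    rcases Set.eq_empty_or_nonempty (interior Q) with hinter | hinter
    · rwa [volume_eq_zero_of_interior_eq_empty hQ hinter]
    obtain ⟨b, hb, hbper, hsupp⟩ := exists_periodic_support hQ hinter hθ hθ' hπ'
      (forall_dirVec_of_forall_regVtx hn hπ' (p := (· ∈ Q))
        fun k => hsub (subset_convexHull ℝ _ ⟨k, rfl⟩))
      (forall_dirVec_of_forall_regVtx hn hπ' (p := (· ∉ interior Q)) fun k => (hfr k).2)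
    have h1 := volume_le_of_support hn hθ hθ' hπ' hb hbper hsupp
    have h2 := sum_edgeGain_le hm hθ hπ hb fun k => by simpa using hbper k
    refine ENNReal.toReal_le_of_le_ofReal hV0 (h1.trans (ENNReal.ofReal_le_ofReal ?_))
    rw [hV]
    push_cast
    gcongr

theorem stmt14 (n : ℕ) (hn : 7 ≤ n) (hmod : n % 4 = 3) :
    maxCircArea n = n * tan (π / n) +
      (sin (π / n) ^ 4 / cos (π / n) ^ 2) *
        (((n : ℝ) + 1) / 4 * tan (2 * π / n) - tan (π / (2 * n))) := by
  obtain ⟨m, rfl⟩ : ∃ m, n = 4 * m + 3 := ⟨n / 4, by lia⟩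
  have hn0 : (0 : ℝ) < (4 * m + 3 : ℕ) := by positivity
  have e1 : 2 * π / (4 * m + 3 : ℕ) = 2 * (π / (4 * m + 3 : ℕ)) := by ring
  have e2 : π / (2 * (4 * m + 3 : ℕ)) = π / (4 * m + 3 : ℕ) / 2 := by field_simp
  have hπ : (4 * m + 3) * (π / (4 * m + 3 : ℕ)) = π := by push_cast at hn0 ⊢; field_simp
  have hθ : 0 < π / (4 * m + 3 : ℕ) := by positivity
  rw [e1, e2, maxCircArea_eq (by lia) hθ hπ]
  generalize π / (4 * m + 3 : ℕ) = θ
  rw [tan_eq_sin_div_cos θ]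
  push_cast
  ring
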